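/- arXiv:2312.10173 — 9 statements merged into one kernel-verified Lean document; each statement's English description precedes it below -/
import Mathlib

section
/- Let A and B be Hopf algebras over a field k, let ◁ : B ⊗ A → B make B a right A-module algebra, and equip the vector space A ⊗ B with the bicrossproduct product (a ⊗ b)(a' ⊗ b') = a a'₁ ⊗ (b ◁ a'₂) b' and unit 1 ⊗ 1. If φ : B → A is a unital anti-algebra map and a coalgebra map satisfying b' ◁ φ(b) = b₁ b' S_B(b₂) for all b, b' ∈ B, then the map t(b) := φ(b₁) ⊗ b₂ satisfies t(b) t(b') = t(b' b) for all b, b' ∈ B; that is, t is a unital algebra map from B^op to the bicrossproduct algebra. -/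
/-!
STATEMENT 1: For Hopf algebras A, B with B a right A-module algebra via ◁, equip A ⊗ B with the
bicrossproduct product (a ⊗ b)(a' ⊗ b') = a a'₁ ⊗ (b ◁ a'₂) b' and unit 1 ⊗ 1.  If φ : B → A is a
unital anti-algebra map and a coalgebra map with b' ◁ φ(b) = b₁ b' S_B(b₂), then
t(b) := φ(b₁) ⊗ b₂ satisfies t(b) t(b') = t(b' b); i.e. t is a unital algebra map from B^op. -/

open TensorProduct

variable (k : Type*) [Field k]

/-- The bicrossproduct multiplication on `A ⊗ B`:
`(a ⊗ b)(a' ⊗ b') = a a'₁ ⊗ (b ◁ a'₂) b'`. -/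
noncomputable def bicrossMul (A B : Type*) [Semiring A] [Semiring B]
    [HopfAlgebra k A] [HopfAlgebra k B] (act : B ⊗[k] A →ₗ[k] B) :
    (A ⊗[k] B) ⊗[k] (A ⊗[k] B) →ₗ[k] A ⊗[k] B :=
  (TensorProduct.map (LinearMap.mul' k A)
      ((LinearMap.mul' k B) ∘ₗ TensorProduct.map act LinearMap.id))
    ∘ₗ (TensorProduct.assoc k (A ⊗[k] A) (B ⊗[k] A) B).toLinearMap
    ∘ₗ TensorProduct.map (TensorProduct.tensorTensorTensorComm k A B A A).toLinearMap LinearMap.id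
    ∘ₗ ((TensorProduct.assoc k (A ⊗[k] B) (A ⊗[k] A) B).symm).toLinearMap
    ∘ₗ TensorProduct.map LinearMap.id
        (TensorProduct.map (Coalgebra.comul (R := k)) LinearMap.id)

/-- The map `t(b) = φ(b₁) ⊗ b₂`. -/
noncomputable def targetMap (A B : Type*) [Semiring A] [Semiring B]
    [HopfAlgebra k A] [HopfAlgebra k B] (φ : B →ₗ[k] A) : B →ₗ[k] A ⊗[k] B :=
  TensorProduct.map φ LinearMap.id ∘ₗ Coalgebra.comul (R := k)

theorem bicrossMul_tmul_tmul {A B : Type*} [Semiring A] [Semiring B]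
    [HopfAlgebra k A] [HopfAlgebra k B] (act : B ⊗[k] A →ₗ[k] B) (c : A) (d : B) (a : A) (e : B) :
    bicrossMul k A B act ((c ⊗ₜ d) ⊗ₜ (a ⊗ₜ e)) =
      TensorProduct.map (LinearMap.mulLeft k c)
        (LinearMap.mulRight k e ∘ₗ act ∘ₗ TensorProduct.mk k B A d) (Coalgebra.comul (R := k) a) := by
  simp only [bicrossMul, LinearMap.comp_apply, TensorProduct.map_tmul, LinearMap.id_apply,
    LinearEquiv.coe_coe]
  induction Coalgebra.comul (R := k) a using TensorProduct.induction_on with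
  | zero => simp
  | tmul x y => simp
  | add x y hx hy => simp only [TensorProduct.tmul_add, TensorProduct.add_tmul, map_add, hx, hy]

/-- The identity `(b₁ d S(b₂)) b₃ = b d` in a Hopf algebra. -/
theorem mul_map_adjoint_comul {B : Type*} [Semiring B] [HopfAlgebra k B] (d b : B) :
    LinearMap.mul' k B (TensorProduct.map
      (LinearMap.mul' k B ∘ₗ TensorProduct.map (LinearMap.mulRight k d)
        (HopfAlgebra.antipode (R := k)) ∘ₗ Coalgebra.comul (R := k)) LinearMap.id
      (Coalgebra.comul (R := k) b)) = b * d := by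
  have hassoc : ∀ z : (B ⊗[k] B) ⊗[k] B,
      LinearMap.mul' k B (TensorProduct.map (LinearMap.mul' k B ∘ₗ
        TensorProduct.map (LinearMap.mulRight k d) (HopfAlgebra.antipode (R := k)))
          LinearMap.id z) =
      LinearMap.mul' k B (TensorProduct.map (LinearMap.mulRight k d) (LinearMap.mul' k B ∘ₗ
        (HopfAlgebra.antipode (R := k)).rTensor B) (TensorProduct.assoc k B B B z)) := by
    refine LinearMap.congr_fun (f := LinearMap.mul' k B ∘ₗ TensorProduct.map (LinearMap.mul' k B ∘ₗ
        TensorProduct.map (LinearMap.mulRight k d) (HopfAlgebra.antipode (R := k))) LinearMap.id)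
      (g := LinearMap.mul' k B ∘ₗ TensorProduct.map (LinearMap.mulRight k d) (LinearMap.mul' k B ∘ₗ
        (HopfAlgebra.antipode (R := k)).rTensor B) ∘ₗ (TensorProduct.assoc k B B B).toLinearMap) ?_
    ext x y z
    simp [mul_assoc]
  have hcomul : TensorProduct.map
      (LinearMap.mul' k B ∘ₗ TensorProduct.map (LinearMap.mulRight k d)
        (HopfAlgebra.antipode (R := k)) ∘ₗ Coalgebra.comul (R := k)) LinearMap.id
      (Coalgebra.comul (R := k) b) = TensorProduct.map (LinearMap.mul' k B ∘ₗ
        TensorProduct.map (LinearMap.mulRight k d) (HopfAlgebra.antipode (R := k)))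
          LinearMap.id ((Coalgebra.comul (R := k)).rTensor B (Coalgebra.comul (R := k) b)) := by
    rw [LinearMap.rTensor, TensorProduct.map_map, LinearMap.comp_id, LinearMap.comp_assoc]
  have hcounit : TensorProduct.map (LinearMap.mulRight k d)
      (Algebra.linearMap k B ∘ₗ Coalgebra.counit (R := k)) (Coalgebra.comul (R := k) b) =
      (b * d) ⊗ₜ 1 := by
    rw [← LinearMap.comp_id (LinearMap.mulRight k d), TensorProduct.map_comp, LinearMap.comp_apply,
      ← LinearMap.lTensor, Coalgebra.lTensor_counit_comul]
    simp
  rw [hcomul, hassoc, Coalgebra.coassoc_apply, LinearMap.lTensor, TensorProduct.map_map,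
    LinearMap.comp_assoc, HopfAlgebra.mul_antipode_rTensor_comul, LinearMap.comp_id, hcounit,
    LinearMap.mul'_apply, mul_one]

/-- Multiplying `c ⊗ d` by `t(b)` gives `c φ(b₁) ⊗ b₂ d`. -/
theorem bicrossMul_tmul_targetMap {A B : Type*} [Semiring A] [Semiring B]
    [HopfAlgebra k A] [HopfAlgebra k B] (act : B ⊗[k] A →ₗ[k] B) (φ : B →ₗ[k] A)
    (hφ_comul : ∀ b : B, Coalgebra.comul (R := k) (φ b) =
      TensorProduct.map φ φ (Coalgebra.comul (R := k) b))
    (hφ4 : ∀ b b' : B, act (b' ⊗ₜ φ b) =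
      LinearMap.mul' k B (TensorProduct.map (LinearMap.mulRight k b')
        (HopfAlgebra.antipode (R := k)) (Coalgebra.comul (R := k) b)))
    (c : A) (d b : B) :
    bicrossMul k A B act ((c ⊗ₜ d) ⊗ₜ targetMap k A B φ b) =
      TensorProduct.map (LinearMap.mulLeft k c ∘ₗ φ) (LinearMap.mulRight k d)
        (Coalgebra.comul (R := k) b) := by
  have hact : act ∘ₗ TensorProduct.mk k B A d ∘ₗ φ = LinearMap.mul' k B ∘ₗ
      TensorProduct.map (LinearMap.mulRight k d) (HopfAlgebra.antipode (R := k)) ∘ₗ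
        Coalgebra.comul (R := k) :=
    LinearMap.ext fun x => hφ4 x d
  have hright : LinearMap.mul' k B ∘ₗ
      TensorProduct.map (act ∘ₗ TensorProduct.mk k B A d ∘ₗ φ) LinearMap.id ∘ₗ
        Coalgebra.comul (R := k) = LinearMap.mulRight k d := by
    ext x
    rw [hact]
    exact mul_map_adjoint_comul k d x
  have hexpand : ∀ z : B ⊗[k] B,
      bicrossMul k A B act ((c ⊗ₜ d) ⊗ₜ TensorProduct.map φ LinearMap.id z) =
      TensorProduct.map (LinearMap.mulLeft k c ∘ₗ φ) (LinearMap.mul' k B ∘ₗ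
        TensorProduct.map (act ∘ₗ TensorProduct.mk k B A d ∘ₗ φ) LinearMap.id)
          (TensorProduct.assoc k B B B ((Coalgebra.comul (R := k)).rTensor B z)) := by
    intro z
    induction z using TensorProduct.induction_on with
    | zero => simp
    | tmul x y =>
      rw [TensorProduct.map_tmul, LinearMap.id_apply, bicrossMul_tmul_tmul, hφ_comul,
        LinearMap.rTensor_tmul]
      induction Coalgebra.comul (R := k) x using TensorProduct.induction_on with
      | zero => simp
      | tmul u v => simp
      | add u v hu hv => simp only [TensorProduct.add_tmul, map_add, hu, hv]
    | add x y hx hy => simp only [TensorProduct.tmul_add, map_add, hx, hy]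
  rw [targetMap, LinearMap.comp_apply, hexpand, Coalgebra.coassoc_apply, ← hright,
    LinearMap.lTensor, TensorProduct.map_map, LinearMap.comp_id, LinearMap.comp_assoc]

theorem target_is_algebra_map_of_op
    {A B : Type*} [Semiring A] [Semiring B] [HopfAlgebra k A] [HopfAlgebra k B]
    (act : B ⊗[k] A →ₗ[k] B)
    -- ◁ is a right action of A on B
    (hact_one : ∀ b : B, act (b ⊗ₜ (1 : A)) = b)
    (hact_mul : ∀ (b : B) (a a' : A), act (act (b ⊗ₜ a) ⊗ₜ a') = act (b ⊗ₜ (a * a')))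
    -- making B a right A-module algebra: (bb') ◁ a = (b ◁ a₁)(b' ◁ a₂) and 1 ◁ a = ε(a)1
    (hact_alg : ∀ (b b' : B) (a : A), act ((b * b') ⊗ₜ a) =
      LinearMap.mul' k B (TensorProduct.map act act
        (TensorProduct.tensorTensorTensorComm k B B A A
          ((b ⊗ₜ b') ⊗ₜ Coalgebra.comul (R := k) a))))
    (hact_unit : ∀ a : A, act ((1 : B) ⊗ₜ a) = Coalgebra.counit (R := k) a • (1 : B))
    (φ : B →ₗ[k] A)
    -- φ is a unital anti-algebra map
    (hφ_mul : ∀ b b' : B, φ (b * b') = φ b' * φ b)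
    (hφ_one : φ 1 = 1)
    -- φ is a coalgebra map
    (hφ_comul : ∀ b : B, Coalgebra.comul (R := k) (φ b) =
      TensorProduct.map φ φ (Coalgebra.comul (R := k) b))
    (hφ_counit : ∀ b : B, Coalgebra.counit (R := k) (φ b) = Coalgebra.counit (R := k) b)
    -- condition (4): b' ◁ φ(b) = b₁ b' S_B(b₂)
    (hφ4 : ∀ b b' : B, act (b' ⊗ₜ φ b) =
      LinearMap.mul' k B (TensorProduct.map (LinearMap.mulRight k b')
        (HopfAlgebra.antipode (R := k)) (Coalgebra.comul (R := k) b))) :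
    (∀ b b' : B, bicrossMul k A B act (targetMap k A B φ b ⊗ₜ targetMap k A B φ b') =
      targetMap k A B φ (b' * b)) ∧
    targetMap k A B φ (1 : B) = (1 : A) ⊗ₜ (1 : B) := by
  refine ⟨fun b b' => ?_, ?_⟩
  · have hmul : ∀ z : B ⊗[k] B, bicrossMul k A B act
        (TensorProduct.map φ LinearMap.id z ⊗ₜ targetMap k A B φ b') =
        TensorProduct.map φ LinearMap.id (Coalgebra.comul (R := k) b' * z) := by
      intro z
      induction z using TensorProduct.induction_on with
      | zero => simp
      | tmul x y =>
        rw [TensorProduct.map_tmul, LinearMap.id_apply,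
          bicrossMul_tmul_targetMap k act φ hφ_comul hφ4]
        induction Coalgebra.comul (R := k) b' using TensorProduct.induction_on with
        | zero => simp
        | tmul u v => simp [hφ_mul]
        | add u v hu hv => simp only [add_mul, map_add, hu, hv]
      | add x y hx hy => simp only [TensorProduct.add_tmul, mul_add, map_add, hx, hy]
    simpa [targetMap] using hmul (Coalgebra.comul (R := k) b)
  · simp [targetMap, Algebra.TensorProduct.one_def, hφ_one]
end

section
/- Let A and B be Hopf algebras over a field k, let δ : A → B ⊗ A, δ(a) = a^{[-1]} ⊗ a^{[0]}, be a left B-comodule structure on A, and equip A ⊗ B with the bicrossproduct coproduct Δ(a ⊗ b) = (a₁ ⊗ a₂^{[-1]} b₁) ⊗ (a₂^{[0]} ⊗ b₂). If φ : B → A is a coalgebra map satisfying φ(b)^{[-1]} ⊗ φ(b)^{[0]} = b₁ S_B(b₃) ⊗ φ(b₂) for all b ∈ B, then the map t(b) := φ(b₁) ⊗ b₂ satisfies Δ(t(b)) = t(b₁) ⊗ t(b₂) for all b ∈ B; that is, t is a coalgebra map from B to the bicrossproduct coalgebra A ⊗ B. -/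
/-!
STATEMENT 2: For Hopf algebras A, B with A a left B-comodule via δ(a) = a^{[-1]} ⊗ a^{[0]},
equip A ⊗ B with the bicrossproduct coproduct Δ(a ⊗ b) = (a₁ ⊗ a₂^{[-1]} b₁) ⊗ (a₂^{[0]} ⊗ b₂).
If φ : B → A is a coalgebra map with φ(b)^{[-1]} ⊗ φ(b)^{[0]} = b₁ S_B(b₃) ⊗ φ(b₂), then
t(b) := φ(b₁) ⊗ b₂ satisfies Δ(t(b)) = t(b₁) ⊗ t(b₂); i.e. t is a coalgebra map. -/

open TensorProduct

variable (k : Type*) [Field k]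

/-- The bicrossproduct comultiplication on `A ⊗ B`:
`Δ(a ⊗ b) = (a₁ ⊗ a₂^{[-1]} b₁) ⊗ (a₂^{[0]} ⊗ b₂)`. -/
noncomputable def bicrossComul (A B : Type*) [Semiring A] [Semiring B]
    [HopfAlgebra k A] [HopfAlgebra k B] (δ : A →ₗ[k] B ⊗[k] A) :
    A ⊗[k] B →ₗ[k] (A ⊗[k] B) ⊗[k] (A ⊗[k] B) :=
  TensorProduct.map
      ((TensorProduct.map LinearMap.id (LinearMap.mul' k B))
        ∘ₗ (TensorProduct.assoc k A B B).toLinearMap) LinearMap.id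
    ∘ₗ (TensorProduct.tensorTensorTensorComm k (A ⊗[k] B) A B B).toLinearMap
    ∘ₗ TensorProduct.map ((TensorProduct.assoc k A B A).symm).toLinearMap LinearMap.id
    ∘ₗ TensorProduct.map (TensorProduct.map LinearMap.id δ) LinearMap.id
    ∘ₗ TensorProduct.map (Coalgebra.comul (R := k)) (Coalgebra.comul (R := k))

section CoalgebraRegroup

variable {k}
variable {B : Type*} [AddCommMonoid B] [Module k B] [Coalgebra k B]

/-- `b₁ ⊗ b₂ ⊗ b₃ ⊗ b₄`, computed as `(Δ ⊗ Δ) ∘ Δ` and as `(id ⊗ (Δ ⊗ id) ∘ Δ) ∘ Δ`. -/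
lemma assoc_map_comul_comul (b : B) :
    (TensorProduct.map LinearMap.id (TensorProduct.assoc k B B B).symm.toLinearMap)
      (TensorProduct.assoc k B B (B ⊗[k] B)
        (TensorProduct.map (Coalgebra.comul (R := k)) (Coalgebra.comul (R := k))
          (Coalgebra.comul (R := k) b))) =
    TensorProduct.map LinearMap.id
      (TensorProduct.map (Coalgebra.comul (R := k)) LinearMap.id ∘ₗ Coalgebra.comul (R := k))
      (Coalgebra.comul (R := k) b) := by
  have nat : TensorProduct.map LinearMap.id (TensorProduct.assoc k B B B).symm.toLinearMap ∘ₗ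
      (TensorProduct.assoc k B B (B ⊗[k] B)).toLinearMap ∘ₗ
        TensorProduct.map (LinearMap.id : B ⊗[k] B →ₗ[k] B ⊗[k] B) (Coalgebra.comul (R := k)) =
      TensorProduct.map LinearMap.id ((TensorProduct.assoc k B B B).symm.toLinearMap ∘ₗ
        TensorProduct.map LinearMap.id (Coalgebra.comul (R := k))) ∘ₗ
          (TensorProduct.assoc k B B B).toLinearMap := by
    ext x y z
    simp
  have coassoc_symm : (TensorProduct.assoc k B B B).symm.toLinearMap ∘ₗ
      TensorProduct.map LinearMap.id (Coalgebra.comul (R := k)) ∘ₗ Coalgebra.comul (R := k) =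
      TensorProduct.map (Coalgebra.comul (R := k)) LinearMap.id ∘ₗ
        Coalgebra.comul (R := k) (A := B) :=
    LinearMap.ext Coalgebra.coassoc_symm_apply
  have h := LinearMap.congr_fun nat
    (TensorProduct.map (Coalgebra.comul (R := k)) LinearMap.id (Coalgebra.comul (R := k) b))
  have hc : TensorProduct.assoc k B B B
      (TensorProduct.map (Coalgebra.comul (R := k)) LinearMap.id (Coalgebra.comul (R := k) b)) =
      TensorProduct.map LinearMap.id (Coalgebra.comul (R := k)) (Coalgebra.comul (R := k) b) :=
    Coalgebra.coassoc_apply b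
  simp only [LinearMap.comp_apply, LinearEquiv.coe_coe, hc] at h
  rw [TensorProduct.map_map, TensorProduct.map_map] at h
  simpa only [LinearMap.id_comp, LinearMap.comp_id, LinearMap.comp_assoc, coassoc_symm] using h

/-- `b₁ ⊗ b₂ ⊗ b₃ ⊗ b₄`, computed as `((id ⊗ Δ) ∘ Δ ⊗ id) ∘ Δ` and as
`(id ⊗ (id ⊗ Δ) ∘ Δ) ∘ Δ`. -/
lemma assoc_map_comul_three (b : B) :
    (TensorProduct.map LinearMap.id (TensorProduct.assoc k B B B).toLinearMap)
      (TensorProduct.assoc k B (B ⊗[k] B) B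
        (TensorProduct.map
          (TensorProduct.map LinearMap.id (Coalgebra.comul (R := k)) ∘ₗ Coalgebra.comul (R := k))
          LinearMap.id (Coalgebra.comul (R := k) b))) =
    TensorProduct.map LinearMap.id
      (TensorProduct.map LinearMap.id (Coalgebra.comul (R := k)) ∘ₗ Coalgebra.comul (R := k))
      (Coalgebra.comul (R := k) b) := by
  have nat : TensorProduct.map LinearMap.id (TensorProduct.assoc k B B B).toLinearMap ∘ₗ
      (TensorProduct.assoc k B (B ⊗[k] B) B).toLinearMap ∘ₗ
        TensorProduct.map (TensorProduct.map LinearMap.id (Coalgebra.comul (R := k)))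
          LinearMap.id =
      TensorProduct.map LinearMap.id ((TensorProduct.assoc k B B B).toLinearMap ∘ₗ
        TensorProduct.map (Coalgebra.comul (R := k)) LinearMap.id) ∘ₗ
          (TensorProduct.assoc k B B B).toLinearMap := by
    ext x y z
    simp
  have coassoc : (TensorProduct.assoc k B B B).toLinearMap ∘ₗ
      TensorProduct.map (Coalgebra.comul (R := k)) LinearMap.id ∘ₗ Coalgebra.comul (R := k) =
      TensorProduct.map LinearMap.id (Coalgebra.comul (R := k)) ∘ₗ
        Coalgebra.comul (R := k) (A := B) :=
    LinearMap.ext Coalgebra.coassoc_apply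
  have h := LinearMap.congr_fun nat
    (TensorProduct.map (Coalgebra.comul (R := k)) LinearMap.id (Coalgebra.comul (R := k) b))
  have hc : TensorProduct.assoc k B B B
      (TensorProduct.map (Coalgebra.comul (R := k)) LinearMap.id (Coalgebra.comul (R := k) b)) =
      TensorProduct.map LinearMap.id (Coalgebra.comul (R := k)) (Coalgebra.comul (R := k) b) :=
    Coalgebra.coassoc_apply b
  simp only [LinearMap.comp_apply, LinearEquiv.coe_coe, hc] at h
  rw [TensorProduct.map_map, TensorProduct.map_map] at h
  simpa only [LinearMap.id_comp, LinearMap.comp_id, LinearMap.comp_assoc, coassoc] using h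

end CoalgebraRegroup

section Coaction

variable {k}
variable {A B : Type*} [AddCommMonoid A] [Module k A] [Semiring B]

/-- The map `(x ⊗ a) ⊗ b ↦ x b ⊗ a`. -/
noncomputable def mulFirst (A B : Type*) [AddCommMonoid A] [Module k A] [Semiring B]
    [Algebra k B] : (B ⊗[k] A) ⊗[k] B →ₗ[k] B ⊗[k] A :=
  TensorProduct.map (LinearMap.mul' k B) LinearMap.id ∘ₗ
    (TensorProduct.rightComm k B A B).toLinearMap

@[simp]
lemma mulFirst_tmul [Algebra k B] (x b : B) (a : A) :
    mulFirst (k := k) A B ((x ⊗ₜ a) ⊗ₜ b) = (x * b) ⊗ₜ a := by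
  simp [mulFirst]

/-- If `δ(φ(b)) = b₁ S(b₃) ⊗ φ(b₂)`, then `φ(b₁)^{[-1]} b₂ ⊗ φ(b₁)^{[0]} = b₁ ⊗ φ(b₂)`. -/
lemma mulFirst_coaction_comul [HopfAlgebra k B] (δ : A →ₗ[k] B ⊗[k] A) (φ : B →ₗ[k] A)
    (hφ : ∀ b : B, δ (φ b) =
      TensorProduct.map (LinearMap.mul' k B) φ
        ((TensorProduct.assoc k B B B).symm
          (TensorProduct.map LinearMap.id
            ((TensorProduct.map (HopfAlgebra.antipode (R := k)) LinearMap.id)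
              ∘ₗ (TensorProduct.comm k B B).toLinearMap)
            (TensorProduct.map LinearMap.id (Coalgebra.comul (R := k))
              (Coalgebra.comul (R := k) b))))) (b : B) :
    mulFirst A B (TensorProduct.map (δ ∘ₗ φ) LinearMap.id (Coalgebra.comul (R := k) b)) =
      TensorProduct.map LinearMap.id φ (Coalgebra.comul (R := k) b) := by
  let conj : B ⊗[k] (B ⊗[k] B) →ₗ[k] B ⊗[k] A :=
    TensorProduct.map (LinearMap.mul' k B) φ ∘ₗ (TensorProduct.assoc k B B B).symm.toLinearMap ∘ₗ
      TensorProduct.map LinearMap.id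
        ((TensorProduct.map (HopfAlgebra.antipode (R := k)) LinearMap.id)
          ∘ₗ (TensorProduct.comm k B B).toLinearMap)
  let mulOuter : B ⊗[k] (B ⊗[k] B) →ₗ[k] B ⊗[k] A :=
    TensorProduct.map (LinearMap.mul' k B) φ ∘ₗ (TensorProduct.assoc k B B B).symm.toLinearMap ∘ₗ
      TensorProduct.map LinearMap.id (TensorProduct.comm k B B).toLinearMap
  have hδ : δ ∘ₗ φ = conj ∘ₗ
      (TensorProduct.map LinearMap.id (Coalgebra.comul (R := k)) ∘ₗ Coalgebra.comul (R := k)) :=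
    LinearMap.ext hφ
  have hmul : mulFirst A B ∘ₗ TensorProduct.map conj LinearMap.id =
      mulOuter ∘ₗ TensorProduct.map LinearMap.id (TensorProduct.map LinearMap.id
          (LinearMap.mul' k B ∘ₗ TensorProduct.map (HopfAlgebra.antipode (R := k)) LinearMap.id)) ∘ₗ
        TensorProduct.map LinearMap.id (TensorProduct.assoc k B B B).toLinearMap ∘ₗ
          (TensorProduct.assoc k B (B ⊗[k] B) B).toLinearMap := by
    ext x y z w
    simp [conj, mulOuter, mul_assoc]
  have hanti : (LinearMap.mul' k B ∘ₗ
      TensorProduct.map (HopfAlgebra.antipode (R := k)) LinearMap.id) ∘ₗ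
        Coalgebra.comul (R := k) = Algebra.linearMap k B ∘ₗ Coalgebra.counit :=
    HopfAlgebra.mul_antipode_rTensor_comul
  have hcounit : TensorProduct.map LinearMap.id (Coalgebra.counit (R := k)) ∘ₗ
      Coalgebra.comul (R := k) = (TensorProduct.mk k B k).flip 1 :=
    Coalgebra.lTensor_counit_comp_comul
  have hone : mulOuter ∘ₗ TensorProduct.map LinearMap.id
      (TensorProduct.map LinearMap.id (Algebra.linearMap k B) ∘ₗ
        (TensorProduct.mk k B k).flip 1) = TensorProduct.map LinearMap.id φ := by
    ext x y
    simp [mulOuter]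
  have h := LinearMap.congr_fun hmul (TensorProduct.map
    (TensorProduct.map LinearMap.id (Coalgebra.comul (R := k)) ∘ₗ Coalgebra.comul (R := k))
      LinearMap.id (Coalgebra.comul (R := k) b))
  simp only [LinearMap.comp_apply, LinearEquiv.coe_coe, assoc_map_comul_three] at h
  rw [TensorProduct.map_map conj, LinearMap.id_comp, ← hδ] at h
  rw [h, ← hone, LinearMap.comp_apply mulOuter, TensorProduct.map_map, ← LinearMap.comp_assoc,
    ← TensorProduct.map_comp, hanti, LinearMap.id_comp, ← hcounit, ← LinearMap.comp_assoc,
    ← TensorProduct.map_comp, LinearMap.id_comp]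

end Coaction

theorem target_is_coalgebra_map
    {A B : Type*} [Semiring A] [Semiring B] [HopfAlgebra k A] [HopfAlgebra k B]
    (δ : A →ₗ[k] B ⊗[k] A)
    -- δ is a left B-comodule structure on A: counitality and coassociativity
    (hδ_counit : ∀ a : A, (TensorProduct.lid k A)
      (TensorProduct.map (Coalgebra.counit (R := k)) LinearMap.id (δ a)) = a)
    (hδ_coassoc : ∀ a : A, (TensorProduct.assoc k B B A)
      (TensorProduct.map (Coalgebra.comul (R := k)) LinearMap.id (δ a)) =
      TensorProduct.map LinearMap.id δ (δ a))
    (φ : B →ₗ[k] A)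
    -- φ is a coalgebra map
    (hφ_comul : ∀ b : B, Coalgebra.comul (R := k) (φ b) =
      TensorProduct.map φ φ (Coalgebra.comul (R := k) b))
    (hφ_counit : ∀ b : B, Coalgebra.counit (R := k) (φ b) = Coalgebra.counit (R := k) b)
    -- condition (1): δ(φ(b)) = b₁ S_B(b₃) ⊗ φ(b₂)
    (hφ1 : ∀ b : B, δ (φ b) =
      TensorProduct.map (LinearMap.mul' k B) φ
        ((TensorProduct.assoc k B B B).symm
          (TensorProduct.map LinearMap.id
            ((TensorProduct.map (HopfAlgebra.antipode (R := k)) LinearMap.id)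
              ∘ₗ (TensorProduct.comm k B B).toLinearMap)
            (TensorProduct.map LinearMap.id (Coalgebra.comul (R := k))
              (Coalgebra.comul (R := k) b))))) :
    ∀ b : B, bicrossComul k A B δ (targetMap k A B φ b) =
      TensorProduct.map (targetMap k A B φ) (targetMap k A B φ) (Coalgebra.comul (R := k) b) := by
  intro b
  let gather : B ⊗[k] ((B ⊗[k] A) ⊗[k] B) →ₗ[k] (A ⊗[k] B) ⊗[k] (A ⊗[k] B) :=
    TensorProduct.map (TensorProduct.map φ LinearMap.id) LinearMap.id ∘ₗ
      (TensorProduct.assoc k B B (A ⊗[k] B)).symm.toLinearMap ∘ₗ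
        TensorProduct.map LinearMap.id (TensorProduct.assoc k B A B).toLinearMap
  let regroup : (B ⊗[k] B) ⊗[k] (B ⊗[k] B) →ₗ[k] B ⊗[k] ((B ⊗[k] B) ⊗[k] B) :=
    TensorProduct.map LinearMap.id (TensorProduct.assoc k B B B).symm.toLinearMap ∘ₗ
      (TensorProduct.assoc k B B (B ⊗[k] B)).toLinearMap
  have hregroup : regroup (TensorProduct.map (Coalgebra.comul (R := k)) (Coalgebra.comul (R := k))
      (Coalgebra.comul (R := k) b)) = TensorProduct.map LinearMap.id
        (TensorProduct.map (Coalgebra.comul (R := k)) LinearMap.id ∘ₗ Coalgebra.comul (R := k))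
        (Coalgebra.comul (R := k) b) :=
    assoc_map_comul_comul b
  have hcomul : Coalgebra.comul (R := k) ∘ₗ φ =
      TensorProduct.map φ φ ∘ₗ Coalgebra.comul (R := k) := LinearMap.ext hφ_comul
  have hkey : (mulFirst A B ∘ₗ TensorProduct.map (δ ∘ₗ φ) LinearMap.id) ∘ₗ
      Coalgebra.comul (R := k) = TensorProduct.map LinearMap.id φ ∘ₗ Coalgebra.comul (R := k) :=
    LinearMap.ext (mulFirst_coaction_comul δ φ hφ1)
  have hright : TensorProduct.map (TensorProduct.map φ LinearMap.id)
      (TensorProduct.map φ LinearMap.id) = gather ∘ₗ TensorProduct.map LinearMap.id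
        (TensorProduct.map (TensorProduct.map LinearMap.id φ) LinearMap.id) ∘ₗ regroup := by
    ext x y z w
    simp [gather, regroup]
  have hleft : TensorProduct.map
      ((TensorProduct.map LinearMap.id (LinearMap.mul' k B))
        ∘ₗ (TensorProduct.assoc k A B B).toLinearMap) LinearMap.id
      ∘ₗ (TensorProduct.tensorTensorTensorComm k (A ⊗[k] B) A B B).toLinearMap
      ∘ₗ TensorProduct.map ((TensorProduct.assoc k A B A).symm).toLinearMap LinearMap.id
      ∘ₗ TensorProduct.map (TensorProduct.map LinearMap.id δ) LinearMap.id
      ∘ₗ TensorProduct.map (TensorProduct.map φ φ) LinearMap.id =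
      gather ∘ₗ TensorProduct.map LinearMap.id (TensorProduct.map
        (mulFirst A B ∘ₗ TensorProduct.map (δ ∘ₗ φ) LinearMap.id) LinearMap.id) ∘ₗ
          regroup := by
    ext x y z w
    simp only [gather, regroup, TensorProduct.AlgebraTensorModule.curry_apply,
      LinearMap.restrictScalars_self, TensorProduct.curry_apply, LinearMap.comp_apply,
      TensorProduct.map_tmul, LinearMap.id_apply, LinearEquiv.coe_coe,
      TensorProduct.assoc_tmul, TensorProduct.assoc_symm_tmul]
    induction δ (φ y) using TensorProduct.induction_on with
    | zero => simp
    | tmul u v => simp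
    | add u v hu hv => simp only [TensorProduct.tmul_add, TensorProduct.add_tmul, map_add, hu, hv]
  have hl : bicrossComul k A B δ (targetMap k A B φ b) =
      gather (TensorProduct.map LinearMap.id (TensorProduct.map
        (mulFirst A B ∘ₗ TensorProduct.map (δ ∘ₗ φ) LinearMap.id) LinearMap.id)
          (regroup (TensorProduct.map (Coalgebra.comul (R := k)) (Coalgebra.comul (R := k))
            (Coalgebra.comul (R := k) b)))) := by
    have h := LinearMap.congr_fun hleft (TensorProduct.map (Coalgebra.comul (R := k))
      (Coalgebra.comul (R := k)) (Coalgebra.comul (R := k) b))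
    simp only [LinearMap.comp_apply] at h
    rw [← h]
    simp only [bicrossComul, targetMap, LinearMap.comp_apply]
    rw [TensorProduct.map_map Coalgebra.comul, hcomul, LinearMap.comp_id,
      TensorProduct.map_map (TensorProduct.map φ φ), LinearMap.id_comp]
  have hr : TensorProduct.map (targetMap k A B φ) (targetMap k A B φ)
      (Coalgebra.comul (R := k) b) =
      gather (TensorProduct.map LinearMap.id
        (TensorProduct.map (TensorProduct.map LinearMap.id φ) LinearMap.id)
          (regroup (TensorProduct.map (Coalgebra.comul (R := k)) (Coalgebra.comul (R := k))
            (Coalgebra.comul (R := k) b)))) := by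
    have h := LinearMap.congr_fun hright (TensorProduct.map (Coalgebra.comul (R := k))
      (Coalgebra.comul (R := k)) (Coalgebra.comul (R := k) b))
    rw [TensorProduct.map_map] at h
    exact h
  rw [hl, hr, hregroup, TensorProduct.map_map, TensorProduct.map_map, ← LinearMap.comp_assoc,
    ← LinearMap.comp_assoc, ← TensorProduct.map_comp, ← TensorProduct.map_comp, hkey]
end

section
/- Let A and B be Hopf algebras over a field k, let ◁ : B ⊗ A → B make B a right A-module algebra, and equip A ⊗ B with the bicrossproduct product (a ⊗ b)(a' ⊗ b') = a a'₁ ⊗ (b ◁ a'₂) b'. If φ : B → A is a coalgebra map satisfying b' ◁ φ(b) = b₁ b' S_B(b₂) for all b, b' ∈ B, then the maps s(b) := 1 ⊗ b and t(b) := φ(b₁) ⊗ b₂ have commuting ranges: s(b') t(b) = t(b) s(b') = φ(b₁) ⊗ b₂ b' for all b, b' ∈ B. -/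
/-!
STATEMENT 3: With the bicrossproduct product on A ⊗ B, if φ : B → A is a coalgebra map with
b' ◁ φ(b) = b₁ b' S_B(b₂), then s(b) := 1 ⊗ b and t(b) := φ(b₁) ⊗ b₂ have commuting ranges:
s(b') t(b) = t(b) s(b') = φ(b₁) ⊗ b₂ b'. -/

open TensorProduct

variable (k : Type*) [Field k]

/-- If `f x = x₁ b' S(x₂)`, then `f(y₁) y₂ = y b'`. -/
theorem mul_map_comul_of_eq_conj {B : Type*} [Semiring B] [HopfAlgebra k B] (f : B →ₗ[k] B)
    (b' : B) (hf : ∀ b : B, f b =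
      LinearMap.mul' k B (TensorProduct.map (LinearMap.mulRight k b')
        (HopfAlgebra.antipode (R := k)) (Coalgebra.comul (R := k) b))) (y : B) :
    LinearMap.mul' k B (f.rTensor B (Coalgebra.comul (R := k) y)) = y * b' := by
  have assoc_form (w : B ⊗[k] B) : LinearMap.mul' k B (f.rTensor B w) =
      LinearMap.mul' k B (TensorProduct.map (LinearMap.mulRight k b')
        (LinearMap.mul' k B ∘ₗ (HopfAlgebra.antipode k).rTensor B)
        (TensorProduct.assoc k B B B ((Coalgebra.comul (R := k)).rTensor B w))) := by
    induction w with
    | zero => simp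
    | add u v hu hv => simp only [map_add, hu, hv]
    | tmul x z =>
      simp only [LinearMap.rTensor_tmul, hf]
      generalize Coalgebra.comul (R := k) x = v
      induction v with
      | zero => simp
      | add u v hu hv => simp only [map_add, TensorProduct.add_tmul, hu, hv]
      | tmul p q => simp [mul_assoc]
  have antipode_form (w : B ⊗[k] B) : LinearMap.mul' k B
      (TensorProduct.map (LinearMap.mulRight k b')
        (LinearMap.mul' k B ∘ₗ (HopfAlgebra.antipode k).rTensor B)
        ((Coalgebra.comul (R := k)).lTensor B w)) =
      TensorProduct.rid k B ((Coalgebra.counit (R := k)).lTensor B w) * b' := by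
    induction w with
    | zero => simp
    | add u v hu hv => simp only [map_add, hu, hv, add_mul]
    | tmul x z => simp [Algebra.algebraMap_eq_smul_one]
  rw [assoc_form, Coalgebra.coassoc_apply, antipode_form, Coalgebra.lTensor_counit_comul]
  simp

/-- Left multiplication by `1 ⊗ b'` on elements `φ(x) ⊗ z`, for `φ` comultiplicative. -/
theorem bicrossMul_one_tmul_map {A B : Type*} [Semiring A] [Semiring B]
    [HopfAlgebra k A] [HopfAlgebra k B] (act : B ⊗[k] A →ₗ[k] B) (φ : B →ₗ[k] A)
    (hφ_comul : ∀ b : B, Coalgebra.comul (R := k) (φ b) =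
      TensorProduct.map φ φ (Coalgebra.comul (R := k) b)) (b' : B) (w : B ⊗[k] B) :
    bicrossMul k A B act (((1 : A) ⊗ₜ b') ⊗ₜ TensorProduct.map φ LinearMap.id w) =
      TensorProduct.map φ
        (LinearMap.mul' k B ∘ₗ (act ∘ₗ TensorProduct.mk k B A b' ∘ₗ φ).rTensor B)
        (TensorProduct.assoc k B B B ((Coalgebra.comul (R := k)).rTensor B w)) := by
  induction w with
  | zero => simp
  | add u v hu hv => simp only [map_add, TensorProduct.tmul_add, hu, hv]
  | tmul x z =>
    simp only [bicrossMul, LinearMap.comp_apply, TensorProduct.map_tmul, LinearMap.id_apply,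
      LinearEquiv.coe_coe, LinearMap.rTensor_tmul, hφ_comul]
    generalize Coalgebra.comul (R := k) x = v
    induction v with
    | zero => simp
    | add u v hu hv =>
      simp only [map_add, TensorProduct.tmul_add, TensorProduct.add_tmul, hu, hv]
    | tmul p q => simp

/-- Right multiplication by `1 ⊗ b'`. -/
theorem bicrossMul_tmul_one_tmul {A B : Type*} [Semiring A] [Semiring B]
    [HopfAlgebra k A] [HopfAlgebra k B] (act : B ⊗[k] A →ₗ[k] B)
    (hact_one : ∀ b : B, act (b ⊗ₜ (1 : A)) = b) (b' : B) (w : A ⊗[k] B) :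
    bicrossMul k A B act (w ⊗ₜ ((1 : A) ⊗ₜ b')) = (LinearMap.mulRight k b').lTensor A w := by
  induction w with
  | zero => simp
  | add u v hu hv => simp only [map_add, TensorProduct.add_tmul, hu, hv]
  | tmul a b => simp [bicrossMul, Algebra.TensorProduct.one_def, hact_one]

theorem source_target_commute
    {A B : Type*} [Semiring A] [Semiring B] [HopfAlgebra k A] [HopfAlgebra k B]
    (act : B ⊗[k] A →ₗ[k] B)
    -- ◁ is a right action of A on B
    (hact_one : ∀ b : B, act (b ⊗ₜ (1 : A)) = b)
    (hact_mul : ∀ (b : B) (a a' : A), act (act (b ⊗ₜ a) ⊗ₜ a') = act (b ⊗ₜ (a * a')))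
    -- making B a right A-module algebra
    (hact_alg : ∀ (b b' : B) (a : A), act ((b * b') ⊗ₜ a) =
      LinearMap.mul' k B (TensorProduct.map act act
        (TensorProduct.tensorTensorTensorComm k B B A A
          ((b ⊗ₜ b') ⊗ₜ Coalgebra.comul (R := k) a))))
    (hact_unit : ∀ a : A, act ((1 : B) ⊗ₜ a) = Coalgebra.counit (R := k) a • (1 : B))
    (φ : B →ₗ[k] A)
    -- φ is a coalgebra map
    (hφ_comul : ∀ b : B, Coalgebra.comul (R := k) (φ b) =
      TensorProduct.map φ φ (Coalgebra.comul (R := k) b))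
    (hφ_counit : ∀ b : B, Coalgebra.counit (R := k) (φ b) = Coalgebra.counit (R := k) b)
    -- condition (4): b' ◁ φ(b) = b₁ b' S_B(b₂)
    (hφ4 : ∀ b b' : B, act (b' ⊗ₜ φ b) =
      LinearMap.mul' k B (TensorProduct.map (LinearMap.mulRight k b')
        (HopfAlgebra.antipode (R := k)) (Coalgebra.comul (R := k) b))) :
    ∀ b b' : B,
      bicrossMul k A B act (((1 : A) ⊗ₜ b') ⊗ₜ targetMap k A B φ b) =
        TensorProduct.map φ (LinearMap.mulRight k b') (Coalgebra.comul (R := k) b) ∧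
      bicrossMul k A B act (targetMap k A B φ b ⊗ₜ ((1 : A) ⊗ₜ b')) =
        TensorProduct.map φ (LinearMap.mulRight k b') (Coalgebra.comul (R := k) b) := by
  intro b b'
  constructor
  · have conj_mul : LinearMap.mul' k B ∘ₗ (act ∘ₗ TensorProduct.mk k B A b' ∘ₗ φ).rTensor B ∘ₗ
        Coalgebra.comul = LinearMap.mulRight k b' :=
      LinearMap.ext fun y => mul_map_comul_of_eq_conj k _ b' (fun x => hφ4 x b') y
    rw [targetMap, LinearMap.comp_apply, bicrossMul_one_tmul_map k act φ hφ_comul,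
      Coalgebra.coassoc_apply, ← LinearMap.comp_apply, LinearMap.map_comp_lTensor,
      LinearMap.comp_assoc, conj_mul]
  · rw [bicrossMul_tmul_one_tmul k act hact_one, targetMap, ← LinearMap.comp_apply,
      ← LinearMap.comp_assoc, LinearMap.lTensor, ← TensorProduct.map_comp]
    rfl
end

section
/- Let A and B be Hopf algebras over a field k with the antipode S_A of A bijective, let ◁ : B ⊗ A → B be a right A-module algebra structure on B, let δ : A → B ⊗ A, δ(a) = a^{[-1]} ⊗ a^{[0]}, be a left B-comodule structure on A, and let φ : B → A be a unital anti-algebra map satisfying (2) φ(a^{[-1]}) ⊗ a^{[0]} = S_A⁻¹(a₃) a₁ ⊗ a₂ for all a ∈ A and (3) φ(b ◁ a) = S_A⁻¹(a₂) φ(b) a₁ for all a ∈ A, b ∈ B. Then for all a ∈ A and b ∈ B the following identity holds in A ⊗ B: a₃ · φ( (b₁ ◁ a₁) · a₂^{[-1]} ) ⊗ (b₂ ◁ a₂^{[0]}) = φ(b₁) a₁ ⊗ (b₂ ◁ a₂). -/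
/-!
STATEMENT 4: With B a right A-module algebra via ◁, A a left B-comodule via δ, φ : B → A a unital
anti-algebra map satisfying (2) φ(a^{[-1]}) ⊗ a^{[0]} = S_A⁻¹(a₃) a₁ ⊗ a₂ and
(3) φ(b ◁ a) = S_A⁻¹(a₂) φ(b) a₁, and S_A bijective (with linear inverse Sinv), one has
a₃ · φ((b₁ ◁ a₁) · a₂^{[-1]}) ⊗ (b₂ ◁ a₂^{[0]}) = φ(b₁) a₁ ⊗ (b₂ ◁ a₂) in A ⊗ B. -/

open TensorProduct

variable (k : Type*) [Field k]

/-- The linear map `(B ⊗ B) ⊗ (A ⊗ A) → A ⊗ B` computing (from `Δb ⊗ Δa`) the element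
`a₃ · φ((b₁ ◁ a₁) · a₂^{[-1]}) ⊗ (b₂ ◁ a₂^{[0]})`. -/
noncomputable def lhsMap (A B : Type*) [Semiring A] [Semiring B]
    [HopfAlgebra k A] [HopfAlgebra k B]
    (act : B ⊗[k] A →ₗ[k] B) (δ : A →ₗ[k] B ⊗[k] A) (φ : B →ₗ[k] A) :
    (B ⊗[k] B) ⊗[k] (A ⊗[k] A) →ₗ[k] A ⊗[k] B :=
  TensorProduct.map
      (LinearMap.mul' k A ∘ₗ (TensorProduct.comm k A A).toLinearMap
        ∘ₗ TensorProduct.map (φ ∘ₗ LinearMap.mul' k B) LinearMap.id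
        ∘ₗ ((TensorProduct.assoc k B B A).symm).toLinearMap) act
    ∘ₗ ((TensorProduct.assoc k B (B ⊗[k] A) (B ⊗[k] A)).symm).toLinearMap
    ∘ₗ TensorProduct.map LinearMap.id
        (TensorProduct.comm k (B ⊗[k] A) (B ⊗[k] A)).toLinearMap
    ∘ₗ TensorProduct.map LinearMap.id
        ((TensorProduct.assoc k B A (B ⊗[k] A)).symm).toLinearMap
    ∘ₗ TensorProduct.map LinearMap.id (TensorProduct.map LinearMap.id
        ((TensorProduct.assoc k A B A).toLinearMap
          ∘ₗ TensorProduct.map (TensorProduct.comm k B A).toLinearMap LinearMap.id))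
    ∘ₗ TensorProduct.map LinearMap.id
        (TensorProduct.map LinearMap.id (TensorProduct.map δ LinearMap.id))
    ∘ₗ TensorProduct.map LinearMap.id
        (TensorProduct.map LinearMap.id (Coalgebra.comul (R := k)))
    ∘ₗ TensorProduct.map act LinearMap.id
    ∘ₗ (TensorProduct.tensorTensorTensorComm k B B A A).toLinearMap

/-- The linear map `(B ⊗ B) ⊗ (A ⊗ A) → A ⊗ B` computing (from `Δb ⊗ Δa`) the element
`φ(b₁) a₁ ⊗ (b₂ ◁ a₂)`. -/
noncomputable def rhsMap (A B : Type*) [Semiring A] [Semiring B]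
    [HopfAlgebra k A] [HopfAlgebra k B]
    (act : B ⊗[k] A →ₗ[k] B) (φ : B →ₗ[k] A) :
    (B ⊗[k] B) ⊗[k] (A ⊗[k] A) →ₗ[k] A ⊗[k] B :=
  TensorProduct.map (LinearMap.mul' k A ∘ₗ TensorProduct.map φ LinearMap.id) act
    ∘ₗ (TensorProduct.tensorTensorTensorComm k B B A A).toLinearMap

section AntipodeTwist

variable {k : Type*} [Field k] {A N : Type*} [Semiring A] [HopfAlgebra k A]
  [AddCommMonoid N] [Module k N] [Module A N] [IsScalarTower k A N]

variable (k A N) in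
/-- The action of an algebra on a left module, as the map `n ⊗ a ↦ a • n`. -/
noncomputable def actOnLeft : N ⊗[k] A →ₗ[k] N :=
  TensorProduct.lift (Algebra.lsmul k k N).toLinearMap.flip

@[simp]
theorem actOnLeft_tmul (n : N) (a : A) : actOnLeft k A N (n ⊗ₜ a) = a • n := rfl

/-- The map `a ↦ s(a₂) • T(a₁)`. -/
noncomputable def antipodeTwist (s : A →ₗ[k] A) (T : A →ₗ[k] N) : A →ₗ[k] N :=
  actOnLeft k A N ∘ₗ TensorProduct.map T s ∘ₗ Coalgebra.comul

/-- The inverse of the antipode satisfies `a₂ s(a₁) = ε(a)`. -/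
theorem mul_antipode_inverse_comul (s : A →ₗ[k] A)
    (hs₁ : ∀ x : A, s (HopfAlgebra.antipode (R := k) x) = x)
    (hs₂ : ∀ x : A, HopfAlgebra.antipode (R := k) (s x) = x) (a : A) :
    actOnLeft k A A (TensorProduct.map s LinearMap.id (Coalgebra.comul (R := k) a)) =
      algebraMap k A (Coalgebra.counit a) := by
  apply Function.LeftInverse.injective hs₁
  have h := HopfAlgebra.mul_antipode_lTensor_comul_apply (R := k) a
  rw [Algebra.algebraMap_eq_smul_one, map_smul, HopfAlgebra.antipode_one,
    ← Algebra.algebraMap_eq_smul_one, ← h]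
  induction Coalgebra.comul (R := k) a with
  | zero => simp
  | add x y hx hy => simp only [map_add, hx, hy]
  | tmul x y => simp [HopfAlgebra.antipode_mul_antidistrib, hs₂]

theorem actOnLeft_antipodeTwist_comul (s : A →ₗ[k] A)
    (hs₁ : ∀ x : A, s (HopfAlgebra.antipode (R := k) x) = x)
    (hs₂ : ∀ x : A, HopfAlgebra.antipode (R := k) (s x) = x) (T : A →ₗ[k] N) (a : A) :
    actOnLeft k A N (TensorProduct.map (antipodeTwist s T) LinearMap.id
      (Coalgebra.comul (R := k) a)) = T a := by
  have assoc_form : ∀ w : A ⊗[k] A,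
      actOnLeft k A N (TensorProduct.map (antipodeTwist s T) LinearMap.id w) =
      actOnLeft k A N (TensorProduct.map T (actOnLeft k A A ∘ₗ TensorProduct.map s LinearMap.id)
        (TensorProduct.assoc k A A A (Coalgebra.comul.rTensor A w))) := by
    intro w
    induction w with
    | zero => simp
    | add x y hx hy => simp only [map_add, hx, hy]
    | tmul x y =>
      simp only [TensorProduct.map_tmul, LinearMap.rTensor_tmul, antipodeTwist,
        LinearMap.comp_apply]
      induction Coalgebra.comul (R := k) x with
      | zero => simp
      | add u v hu hv => simp only [map_add, TensorProduct.add_tmul, hu, hv]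
      | tmul u v => simp [mul_smul]
  have counit_form : ∀ w : A ⊗[k] A,
      actOnLeft k A N (TensorProduct.map T (actOnLeft k A A ∘ₗ TensorProduct.map s LinearMap.id)
        (Coalgebra.comul.lTensor A w)) =
      actOnLeft k A N (TensorProduct.map T (Algebra.linearMap k A)
        (Coalgebra.counit.lTensor A w)) := by
    intro w
    induction w with
    | zero => simp
    | add x y hx hy => simp only [map_add, hx, hy]
    | tmul x y => simp [mul_antipode_inverse_comul s hs₁ hs₂]
  rw [assoc_form, Coalgebra.coassoc_apply, counit_form, Coalgebra.lTensor_counit_comul]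
  simp

end AntipodeTwist

section LhsMap

variable {k : Type*} [Field k] {A B : Type*} [Semiring A] [Semiring B]
  [HopfAlgebra k A] [HopfAlgebra k B]

theorem lhsMap_tmul (act : B ⊗[k] A →ₗ[k] B) (δ : A →ₗ[k] B ⊗[k] A) (φ : B →ₗ[k] A)
    (hφ_mul : ∀ b b' : B, φ (b * b') = φ b' * φ b) (b b' : B) (x y : A) :
    lhsMap k A B act δ φ ((b ⊗ₜ b') ⊗ₜ (x ⊗ₜ y)) =
      actOnLeft k A (A ⊗[k] B) (TensorProduct.map
        (TensorProduct.map (LinearMap.mulRight k (φ (act (b ⊗ₜ x))))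
          (act ∘ₗ TensorProduct.mk k B A b') ∘ₗ TensorProduct.map φ LinearMap.id ∘ₗ δ)
        LinearMap.id (Coalgebra.comul (R := k) y)) := by
  simp only [lhsMap, LinearMap.comp_apply, LinearEquiv.coe_coe, TensorProduct.map_tmul,
    TensorProduct.tensorTensorTensorComm_tmul, LinearMap.id_apply]
  induction Coalgebra.comul (R := k) y with
  | zero => simp
  | add u v hu hv => simp only [map_add, TensorProduct.tmul_add, hu, hv]
  | tmul u v =>
    simp only [TensorProduct.map_tmul, LinearMap.comp_apply, LinearMap.id_apply]
    induction δ u with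
    | zero => simp
    | add p q hp hq =>
      simp only [map_add, TensorProduct.tmul_add, TensorProduct.add_tmul, hp, hq]
    | tmul p q => simp [hφ_mul, TensorProduct.smul_tmul']

end LhsMap

theorem takeuchi_identity
    {A B : Type*} [Semiring A] [Semiring B] [HopfAlgebra k A] [HopfAlgebra k B]
    -- S_A is bijective with linear inverse Sinv
    (Sinv : A →ₗ[k] A)
    (hSinv₁ : ∀ x : A, Sinv (HopfAlgebra.antipode (R := k) x) = x)
    (hSinv₂ : ∀ x : A, HopfAlgebra.antipode (R := k) (Sinv x) = x)
    (act : B ⊗[k] A →ₗ[k] B)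
    -- ◁ is a right action of A on B, making B a right A-module algebra
    (hact_one : ∀ b : B, act (b ⊗ₜ (1 : A)) = b)
    (hact_mul : ∀ (b : B) (a a' : A), act (act (b ⊗ₜ a) ⊗ₜ a') = act (b ⊗ₜ (a * a')))
    (hact_alg : ∀ (b b' : B) (a : A), act ((b * b') ⊗ₜ a) =
      LinearMap.mul' k B (TensorProduct.map act act
        (TensorProduct.tensorTensorTensorComm k B B A A
          ((b ⊗ₜ b') ⊗ₜ Coalgebra.comul (R := k) a))))
    (hact_unit : ∀ a : A, act ((1 : B) ⊗ₜ a) = Coalgebra.counit (R := k) a • (1 : B))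
    (δ : A →ₗ[k] B ⊗[k] A)
    -- δ is a left B-comodule structure on A
    (hδ_counit : ∀ a : A, (TensorProduct.lid k A)
      (TensorProduct.map (Coalgebra.counit (R := k)) LinearMap.id (δ a)) = a)
    (hδ_coassoc : ∀ a : A, (TensorProduct.assoc k B B A)
      (TensorProduct.map (Coalgebra.comul (R := k)) LinearMap.id (δ a)) =
      TensorProduct.map LinearMap.id δ (δ a))
    (φ : B →ₗ[k] A)
    -- φ is a unital anti-algebra map
    (hφ_mul : ∀ b b' : B, φ (b * b') = φ b' * φ b)
    (hφ_one : φ 1 = 1)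
    -- condition (2): φ(a^{[-1]}) ⊗ a^{[0]} = S_A⁻¹(a₃) a₁ ⊗ a₂
    (hφ2 : ∀ a : A, TensorProduct.map φ LinearMap.id (δ a) =
      TensorProduct.map (LinearMap.mul' k A) LinearMap.id
        ((TensorProduct.assoc k A A A).symm
          ((TensorProduct.comm k (A ⊗[k] A) A)
            (TensorProduct.map LinearMap.id Sinv
              (TensorProduct.map (Coalgebra.comul (R := k)) LinearMap.id
                (Coalgebra.comul (R := k) a))))))
    -- condition (3): φ(b ◁ a) = S_A⁻¹(a₂) φ(b) a₁
    (hφ3 : ∀ (b : B) (a : A), φ (act (b ⊗ₜ a)) =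
      LinearMap.mul' k A (TensorProduct.map Sinv (LinearMap.mulLeft k (φ b))
        ((TensorProduct.comm k A A) (Coalgebra.comul (R := k) a)))) :
    ∀ (a : A) (b : B),
      lhsMap k A B act δ φ (Coalgebra.comul (R := k) b ⊗ₜ Coalgebra.comul (R := k) a) =
      rhsMap k A B act φ (Coalgebra.comul (R := k) b ⊗ₜ Coalgebra.comul (R := k) a) := by
  have coact_eq (b' : B) (c : A) :
      TensorProduct.map (LinearMap.mulRight k c) (act ∘ₗ TensorProduct.mk k B A b') ∘ₗ
        TensorProduct.map φ LinearMap.id ∘ₗ δ =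
      antipodeTwist Sinv (TensorProduct.map (LinearMap.mulRight k c)
        (act ∘ₗ TensorProduct.mk k B A b') ∘ₗ Coalgebra.comul) := by
    ext a
    simp only [antipodeTwist, LinearMap.comp_apply, hφ2]
    induction Coalgebra.comul (R := k) a with
    | zero => simp
    | add u v hu hv => simp only [map_add, hu, hv]
    | tmul u v =>
      simp only [TensorProduct.map_tmul, LinearMap.comp_apply]
      induction Coalgebra.comul (R := k) u with
      | zero => simp
      | add p q hp hq => simp only [map_add, TensorProduct.add_tmul, hp, hq]
      | tmul p q => simp [TensorProduct.smul_tmul', mul_assoc]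
  have act_eq (b b' : B) (y : A) :
      (TensorProduct.mk k A B).flip (act (b' ⊗ₜ y)) ∘ₗ φ ∘ₗ act ∘ₗ TensorProduct.mk k B A b =
      antipodeTwist Sinv ((TensorProduct.mk k A B).flip (act (b' ⊗ₜ y)) ∘ₗ
        LinearMap.mulLeft k (φ b)) := by
    ext a
    simp only [antipodeTwist, LinearMap.comp_apply, TensorProduct.mk_apply, hφ3]
    induction Coalgebra.comul (R := k) a with
    | zero => simp
    | add u v hu hv => simp only [map_add, hu, hv]
    | tmul u v => simp [TensorProduct.smul_tmul']
  intro a b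
  induction Coalgebra.comul (R := k) b with
  | zero => simp
  | add u v hu hv => simp only [map_add, TensorProduct.add_tmul, hu, hv]
  | tmul b b' =>
    let M : (A ⊗[k] A) ⊗[k] A →ₗ[k] A ⊗[k] B :=
      TensorProduct.map
        (actOnLeft k A A ∘ₗ TensorProduct.map (φ ∘ₗ act ∘ₗ TensorProduct.mk k B A b) LinearMap.id)
        (act ∘ₗ TensorProduct.mk k B A b')
    have lhs_eq (w : A ⊗[k] A) : lhsMap k A B act δ φ ((b ⊗ₜ b') ⊗ₜ w) =
        M ((TensorProduct.assoc k A A A).symm (Coalgebra.comul.lTensor A w)) := by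
      induction w with
      | zero => simp
      | add u v hu hv => simp only [map_add, TensorProduct.tmul_add, hu, hv]
      | tmul x y =>
        rw [lhsMap_tmul act δ φ hφ_mul, coact_eq,
          actOnLeft_antipodeTwist_comul Sinv hSinv₁ hSinv₂, LinearMap.lTensor_tmul,
          LinearMap.comp_apply]
        induction Coalgebra.comul (R := k) y with
        | zero => simp
        | add u v hu hv => simp only [map_add, TensorProduct.tmul_add, hu, hv]
        | tmul u v => simp [M]
    have rhs_eq (w : A ⊗[k] A) : M (Coalgebra.comul.rTensor A w) =
        rhsMap k A B act φ ((b ⊗ₜ b') ⊗ₜ w) := by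
      induction w with
      | zero => simp
      | add u v hu hv => simp only [map_add, TensorProduct.tmul_add, hu, hv]
      | tmul x y =>
        have h := actOnLeft_antipodeTwist_comul Sinv hSinv₁ hSinv₂
          ((TensorProduct.mk k A B).flip (act (b' ⊗ₜ y)) ∘ₗ LinearMap.mulLeft k (φ b)) x
        rw [← act_eq] at h
        trans ((TensorProduct.mk k A B).flip (act (b' ⊗ₜ y)) ∘ₗ LinearMap.mulLeft k (φ b)) x
        · rw [← h, LinearMap.rTensor_tmul]
          induction Coalgebra.comul (R := k) x with
          | zero => simp
          | add u v hu hv => simp only [map_add, TensorProduct.add_tmul, hu, hv]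
          | tmul u v => simp [M, TensorProduct.smul_tmul']
        · simp [rhsMap]
    rw [lhs_eq, Coalgebra.coassoc_symm_apply, rhs_eq]
end

section
/- Let H be a Hopf algebra over a field k with bijective antipode S. With the right adjoint action g ◁ h = S(h₁) g h₂ and the coaction δ(h) = S(h₁)h₃ ⊗ h₂ = h^{[-1]} ⊗ h^{[0]}, the bicrossproduct compatibility conditions for the pair (H, H_cop) hold; explicitly, for all g, h ∈ H: (iii) (g ◁ h)₂ ⊗ (g ◁ h)₁ = (g₂ ◁ h₁)·(h₂)^{[-1]} ⊗ (g₁ ◁ (h₂)^{[0]}), and (iv) (h₁)^{[-1]}·(g ◁ h₂) ⊗ (h₁)^{[0]} = (g ◁ h₁)·(h₂)^{[-1]} ⊗ (h₂)^{[0]}, where all products are taken in H. -/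
/-!
STATEMENT 9: For a Hopf algebra H with bijective antipode, with the right adjoint action
g ◁ h = S(h₁) g h₂ and the coaction δ(h) = S(h₁)h₃ ⊗ h₂, the bicrossproduct compatibility
conditions for the pair (H, H_cop) hold:
(iii) (g ◁ h)₂ ⊗ (g ◁ h)₁ = (g₂ ◁ h₁)·(h₂)^{[-1]} ⊗ (g₁ ◁ (h₂)^{[0]}),
(iv) (h₁)^{[-1]}·(g ◁ h₂) ⊗ (h₁)^{[0]} = (g ◁ h₁)·(h₂)^{[-1]} ⊗ (h₂)^{[0]},
with all products taken in H. -/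

open TensorProduct

variable (k : Type*) [Field k]

/-- The right adjoint action `g ◁ h = S(h₁) g h₂`. -/
noncomputable def adAction (H : Type*) [Semiring H] [HopfAlgebra k H] :
    H ⊗[k] H →ₗ[k] H :=
  LinearMap.mul' k H
    ∘ₗ TensorProduct.map LinearMap.id
        (LinearMap.mul' k H ∘ₗ (TensorProduct.comm k H H).toLinearMap)
    ∘ₗ (TensorProduct.assoc k H H H).toLinearMap
    ∘ₗ TensorProduct.map (TensorProduct.map (HopfAlgebra.antipode (R := k)) LinearMap.id)
        LinearMap.id
    ∘ₗ TensorProduct.map (Coalgebra.comul (R := k)) LinearMap.id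
    ∘ₗ (TensorProduct.comm k H H).toLinearMap

/-- The coaction `δ(h) = S(h₁)h₃ ⊗ h₂` of `H_cop` on `H`. -/
noncomputable def adCoaction (H : Type*) [Semiring H] [HopfAlgebra k H] :
    H →ₗ[k] H ⊗[k] H :=
  TensorProduct.map (LinearMap.mul' k H) LinearMap.id
    ∘ₗ ((TensorProduct.assoc k H H H).symm).toLinearMap
    ∘ₗ TensorProduct.map LinearMap.id (TensorProduct.comm k H H).toLinearMap
    ∘ₗ (TensorProduct.assoc k H H H).toLinearMap
    ∘ₗ TensorProduct.map (TensorProduct.map (HopfAlgebra.antipode (R := k)) LinearMap.id)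
        LinearMap.id
    ∘ₗ TensorProduct.map (Coalgebra.comul (R := k)) LinearMap.id
    ∘ₗ Coalgebra.comul (R := k)

open WithConv Algebra.TensorProduct

section Convolution

variable {k}
variable {H A : Type*} [Semiring H] [Semiring A] [Algebra k A]

/-- The convolution element `h ↦ ε(h) c`. -/
noncomputable def convConst (H : Type*) [Semiring H] [Bialgebra k H] (c : A) :
    WithConv (H →ₗ[k] A) :=
  toConv (LinearMap.toSpanSingleton k A c ∘ₗ Coalgebra.counit)

theorem convConst_mul_apply [Bialgebra k H] (c : A) (f : WithConv (H →ₗ[k] A)) (h : H) :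
    (convConst H c * f).ofConv h = c * f.ofConv h := by
  conv_rhs => rw [← one_mul f]
  rw [(Coalgebra.Repr.arbitrary k h).convMul_apply, (Coalgebra.Repr.arbitrary k h).convMul_apply]
  simp [convConst, Finset.mul_sum, Algebra.algebraMap_eq_smul_one]

theorem mul_convConst_apply [Bialgebra k H] (c : A) (f : WithConv (H →ₗ[k] A)) (h : H) :
    (f * convConst H c).ofConv h = f.ofConv h * c := by
  conv_rhs => rw [← mul_one f]
  rw [(Coalgebra.Repr.arbitrary k h).convMul_apply, (Coalgebra.Repr.arbitrary k h).convMul_apply]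
  simp [convConst, Finset.sum_mul, Algebra.algebraMap_eq_smul_one]

theorem convConst_mul [Bialgebra k H] (c d : A) :
    convConst (k := k) H (c * d) = convConst H c * convConst H d := by
  ext h
  rw [convConst_mul_apply]
  simp [convConst]

theorem convConst_add [Bialgebra k H] (c d : A) :
    convConst (k := k) H (c + d) = convConst H c + convConst H d := by
  ext h
  simp [convConst]

theorem convConst_comm [Bialgebra k H] (c : A) (f : WithConv (H →ₗ[k] A))
    (hc : ∀ h, c * f.ofConv h = f.ofConv h * c) : convConst H c * f = f * convConst H c := by
  ext h
  rw [convConst_mul_apply, hc, mul_convConst_apply]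

variable [HopfAlgebra k H]

/-- An algebra homomorphism as an element of the convolution algebra. -/
def convHom (φ : H →ₐ[k] A) : WithConv (H →ₗ[k] A) := toConv φ.toLinearMap

/-- The convolution inverse of an algebra homomorphism. -/
noncomputable def convAnti (φ : H →ₐ[k] A) : WithConv (H →ₗ[k] A) :=
  toConv (φ.toLinearMap ∘ₗ HopfAlgebra.antipode k)

theorem toConv_algHom_comp_one {B : Type*} [Semiring B] [Algebra k B] (φ : B →ₐ[k] A) :
    toConv (φ.toLinearMap ∘ₗ (1 : WithConv (H →ₗ[k] B)).ofConv) = 1 := by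
  ext h
  simp

theorem convHom_mul_convAnti (φ : H →ₐ[k] A) : convHom φ * convAnti φ = 1 := by
  rw [← toConv_algHom_comp_one φ, ← LinearMap.id_mul_antipode,
    LinearMap.algHom_comp_convMul_distrib]
  rfl

theorem convAnti_mul_convHom (φ : H →ₐ[k] A) : convAnti φ * convHom φ = 1 := by
  rw [← toConv_algHom_comp_one φ, ← LinearMap.antipode_mul_id,
    LinearMap.algHom_comp_convMul_distrib]
  rfl

theorem algHom_comp_adAction (φ : H →ₐ[k] A) (g : H) :
    toConv (φ.toLinearMap ∘ₗ adAction k H ∘ₗ TensorProduct.mk k H H g) =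
      convAnti φ * convConst H (φ g) * convHom φ := by
  rw [mul_assoc]
  ext h
  rw [LinearMap.convMul_def]
  change φ (adAction k H (g ⊗ₜ h)) = LinearMap.mul' k A (TensorProduct.map _ _ _)
  simp only [adAction, LinearMap.comp_apply, LinearEquiv.coe_coe, TensorProduct.comm_tmul,
    TensorProduct.map_tmul, LinearMap.id_apply]
  induction Coalgebra.comul (R := k) h with
  | zero => simp
  | add x y hx hy => simp only [map_add, add_tmul, hx, hy]
  | tmul x y =>
    simp only [TensorProduct.map_tmul, LinearMap.mul'_apply, convConst_mul_apply]
    simp [convAnti, convHom]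

end Convolution

section Coaction

variable {k}
variable {H : Type*} [Semiring H] [HopfAlgebra k H]

theorem map_id_comp_adCoaction (f : H →ₗ[k] H) :
    toConv (TensorProduct.map LinearMap.id f ∘ₗ adCoaction k H) =
      convAnti includeLeft * toConv ((includeRight : H →ₐ[k] H ⊗[k] H).toLinearMap ∘ₗ f) *
        convHom includeLeft := by
  ext h
  rw [LinearMap.convMul_def]
  change TensorProduct.map LinearMap.id f (adCoaction k H h) =
    LinearMap.mul' k _ (TensorProduct.map _ _ _)
  simp only [adCoaction, LinearMap.comp_apply]
  induction Coalgebra.comul (R := k) h with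
  | zero => simp
  | add x y hx hy => simp only [map_add, hx, hy]
  | tmul x y =>
    rw [LinearMap.convMul_def]
    simp only [TensorProduct.map_tmul, LinearMap.comp_apply]
    induction Coalgebra.comul (R := k) x with
    | zero => simp
    | add x y hx hy => simp only [map_add, add_tmul, hx, hy]
    | tmul u v => simp [convAnti, convHom]

theorem convHom_comm_comul :
    convHom ((Algebra.TensorProduct.comm k H H).toAlgHom.comp (Bialgebra.comulAlgHom k H)) =
      convHom includeRight * convHom includeLeft := by
  ext h
  rw [LinearMap.convMul_def]
  change TensorProduct.comm k H H (Coalgebra.comul h) =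
    LinearMap.mul' k _ (TensorProduct.map _ _ _)
  induction Coalgebra.comul (R := k) h with
  | zero => simp
  | add x y hx hy => simp only [map_add, hx, hy]
  | tmul x y => simp [convHom]

theorem convAnti_comm_comul :
    convAnti ((Algebra.TensorProduct.comm k H H).toAlgHom.comp (Bialgebra.comulAlgHom k H)) =
      convAnti includeLeft * convAnti includeRight := by
  refine left_inv_eq_right_inv (convAnti_mul_convHom _) ?_
  rw [convHom_comm_comul, mul_assoc, ← mul_assoc (convHom includeLeft), convHom_mul_convAnti,
    one_mul, convHom_mul_convAnti]

theorem convConst_includeLeft_comm (g : H) (f : H →ₗ[k] H) :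
    convConst H ((includeLeft : H →ₐ[k] H ⊗[k] H) g) *
        toConv ((includeRight : H →ₐ[k] H ⊗[k] H).toLinearMap ∘ₗ f) =
      toConv ((includeRight : H →ₐ[k] H ⊗[k] H).toLinearMap ∘ₗ f) *
        convConst H ((includeLeft : H →ₐ[k] H ⊗[k] H) g) :=
  convConst_comm _ _ fun h => by simp

theorem adAction_twist_comul (g h : H) :
    (TensorProduct.comm k H H) (Coalgebra.comul (R := k) (adAction k H (g ⊗ₜ h))) =
      (convAnti includeLeft * convAnti includeRight *
        convConst H (TensorProduct.comm k H H (Coalgebra.comul g)) *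
        (convHom includeRight * convHom includeLeft) : WithConv (H →ₗ[k] H ⊗[k] H)).ofConv h := by
  rw [← convAnti_comm_comul, ← convHom_comm_comul]
  exact congr(($(algHom_comp_adAction ((Algebra.TensorProduct.comm k H H).toAlgHom.comp
    (Bialgebra.comulAlgHom k H)) g)).ofConv h)

end Coaction

theorem mirror_bicross_compatibilities
    {H : Type*} [Semiring H] [HopfAlgebra k H]
    (hS : Function.Bijective (HopfAlgebra.antipode (R := k) (A := H))) :
    -- (iii): (g ◁ h)₂ ⊗ (g ◁ h)₁ = (g₂ ◁ h₁)·(h₂)^{[-1]} ⊗ (g₁ ◁ (h₂)^{[0]})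
    (∀ g h : H,
      (TensorProduct.comm k H H) (Coalgebra.comul (R := k) (adAction k H (g ⊗ₜ h))) =
      (TensorProduct.map (LinearMap.mul' k H) (adAction k H)
        ∘ₗ ((TensorProduct.assoc k H H (H ⊗[k] H)).symm).toLinearMap
        ∘ₗ TensorProduct.map LinearMap.id (TensorProduct.assoc k H H H).toLinearMap
        ∘ₗ TensorProduct.map LinearMap.id
            (TensorProduct.map (TensorProduct.comm k H H).toLinearMap LinearMap.id)
        ∘ₗ TensorProduct.map LinearMap.id ((TensorProduct.assoc k H H H).symm).toLinearMap
        ∘ₗ TensorProduct.map (adAction k H) LinearMap.id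
        ∘ₗ TensorProduct.map LinearMap.id (TensorProduct.map LinearMap.id (adCoaction k H))
        ∘ₗ (TensorProduct.tensorTensorTensorComm k H H H H).toLinearMap)
        (((TensorProduct.comm k H H) (Coalgebra.comul (R := k) g)) ⊗ₜ
          Coalgebra.comul (R := k) h)) ∧
    -- (iv): (h₁)^{[-1]}·(g ◁ h₂) ⊗ (h₁)^{[0]} = (g ◁ h₁)·(h₂)^{[-1]} ⊗ (h₂)^{[0]}
    (∀ g h : H,
      (TensorProduct.map (LinearMap.mul' k H) LinearMap.id
        ∘ₗ ((TensorProduct.assoc k H H H).symm).toLinearMap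
        ∘ₗ TensorProduct.map LinearMap.id (TensorProduct.comm k H H).toLinearMap
        ∘ₗ (TensorProduct.assoc k H H H).toLinearMap
        ∘ₗ TensorProduct.map (adCoaction k H) (adAction k H ∘ₗ TensorProduct.mk k H H g))
          (Coalgebra.comul (R := k) h) =
      (TensorProduct.map (LinearMap.mul' k H) LinearMap.id
        ∘ₗ ((TensorProduct.assoc k H H H).symm).toLinearMap
        ∘ₗ TensorProduct.map (adAction k H ∘ₗ TensorProduct.mk k H H g) (adCoaction k H))
          (Coalgebra.comul (R := k) h)) := by
  constructor
  · intro g h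
    rw [adAction_twist_comul]
    induction TensorProduct.comm k H H (Coalgebra.comul (R := k) g) with
    | zero =>
      have : convConst (k := k) H (0 : H ⊗[k] H) = 0 := by ext; simp [convConst]
      simp [this]
    | add x y hx hy =>
      rw [convConst_add, mul_add, add_mul, add_tmul, map_add, ← hx, ← hy]
      rfl
    | tmul a b =>
      have hab : (a ⊗ₜ[k] b : H ⊗[k] H) =
          (includeLeft : H →ₐ[k] H ⊗[k] H) a * (includeRight : H →ₐ[k] H ⊗[k] H) b := by simp
      have key : (convAnti includeLeft * convAnti includeRight * convConst H (a ⊗ₜ[k] b) *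
          (convHom includeRight * convHom includeLeft) : WithConv (H →ₗ[k] H ⊗[k] H)) =
          toConv ((includeLeft : H →ₐ[k] H ⊗[k] H).toLinearMap ∘ₗ
            adAction k H ∘ₗ TensorProduct.mk k H H a) *
          toConv (TensorProduct.map LinearMap.id (adAction k H ∘ₗ TensorProduct.mk k H H b) ∘ₗ
            adCoaction k H) := by
        have comm := convConst_includeLeft_comm a (HopfAlgebra.antipode k (A := H))
        change _ * convAnti includeRight = convAnti includeRight * _ at comm
        rw [map_id_comp_adCoaction, algHom_comp_adAction, algHom_comp_adAction, hab, convConst_mul]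
        simp only [mul_assoc]
        rw [← mul_assoc (convHom includeLeft) (convAnti includeLeft), convHom_mul_convAnti,
          one_mul, ← mul_assoc (convConst H _) (convAnti includeRight), comm, mul_assoc]
      rw [key, LinearMap.convMul_def]
      simp only [LinearMap.comp_apply]
      induction Coalgebra.comul (R := k) h with
      | zero => simp
      | add x y hx hy => simp only [map_add, tmul_add, hx, hy]
      | tmul x y =>
        simp only [TensorProduct.map_tmul, LinearMap.comp_apply, LinearEquiv.coe_coe,
          TensorProduct.tensorTensorTensorComm_tmul, LinearMap.id_apply]
        induction adCoaction k H y with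
        | zero => simp
        | add x y hx hy => simp only [map_add, tmul_add, hx, hy]
        | tmul u v => simp
  · intro g h
    have key : toConv (adCoaction k H) *
        toConv ((includeLeft : H →ₐ[k] H ⊗[k] H).toLinearMap ∘ₗ
          adAction k H ∘ₗ TensorProduct.mk k H H g) =
        toConv ((includeLeft : H →ₐ[k] H ⊗[k] H).toLinearMap ∘ₗ
          adAction k H ∘ₗ TensorProduct.mk k H H g) * toConv (adCoaction k H) := by
      have comm := convConst_includeLeft_comm (k := k) g LinearMap.id
      have coact := map_id_comp_adCoaction (k := k) (H := H) LinearMap.id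
      rw [TensorProduct.map_id, LinearMap.id_comp] at coact
      rw [coact, algHom_comp_adAction]
      simp only [mul_assoc]
      rw [← mul_assoc (convHom includeLeft) (convAnti includeLeft), convHom_mul_convAnti,
        one_mul, ← mul_assoc (convHom includeLeft) (convAnti includeLeft), convHom_mul_convAnti,
        one_mul, ← mul_assoc (convConst H _) (toConv _), comm, mul_assoc]
    have key_h := congr(($key).ofConv h)
    simp only [LinearMap.convMul_def] at key_h
    convert key_h using 1
    · simp only [LinearMap.comp_apply]
      induction Coalgebra.comul (R := k) h with
      | zero => simp
      | add x y hx hy => simp only [map_add, hx, hy]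
      | tmul x y =>
        simp only [TensorProduct.map_tmul, LinearMap.comp_apply]
        induction adCoaction k H x with
        | zero => simp
        | add x y hx hy => simp only [map_add, add_tmul, hx, hy]
        | tmul u v => simp
    · simp only [LinearMap.comp_apply]
      induction Coalgebra.comul (R := k) h with
      | zero => simp
      | add x y hx hy => simp only [map_add, hx, hy]
      | tmul x y =>
        simp only [TensorProduct.map_tmul, LinearMap.comp_apply]
        induction adCoaction k H y with
        | zero => simp
        | add x y hx hy => simp only [map_add, tmul_add, hx, hy]
        | tmul u v => simp
end

section
/- Let H be a Hopf algebra over a field k with bijective antipode S. Then the vector space H ⊗ H equipped with the product (a ⊗ b)(a' ⊗ b') = a a'₁ ⊗ S(a'₂) b a'₃ b', unit 1 ⊗ 1, coproduct Δ(a ⊗ b) = (a₁ ⊗ S(a₂) a₄ b₂) ⊗ (a₃ ⊗ b₁), and counit a ⊗ b ↦ ε(a)ε(b), is a bialgebra which admits an antipode, hence is a Hopf algebra (the mirror bicrossproduct H ▷◀ H_cop). -/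
/-!
STATEMENT 10: For a Hopf algebra H with bijective antipode S, the vector space H ⊗ H with product
(a ⊗ b)(a' ⊗ b') = a a'₁ ⊗ S(a'₂) b a'₃ b', unit 1 ⊗ 1, coproduct
Δ(a ⊗ b) = (a₁ ⊗ S(a₂) a₄ b₂) ⊗ (a₃ ⊗ b₁) and counit ε(a)ε(b) is a bialgebra admitting an
antipode, hence a Hopf algebra (the mirror bicrossproduct H ▷◀ H_cop). -/

open TensorProduct

variable (k : Type*) [Field k]

/-- The mirror bicrossproduct multiplication on `H ⊗ H`:
`(a ⊗ b)(a' ⊗ b') = a a'₁ ⊗ S(a'₂) b a'₃ b'`. -/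
noncomputable def mirrorMul (H : Type*) [Semiring H] [HopfAlgebra k H] :
    (H ⊗[k] H) ⊗[k] (H ⊗[k] H) →ₗ[k] H ⊗[k] H :=
  (TensorProduct.map (LinearMap.mul' k H)
      ((LinearMap.mul' k H) ∘ₗ TensorProduct.map (adAction k H) LinearMap.id))
    ∘ₗ (TensorProduct.assoc k (H ⊗[k] H) (H ⊗[k] H) H).toLinearMap
    ∘ₗ TensorProduct.map (TensorProduct.tensorTensorTensorComm k H H H H).toLinearMap LinearMap.id
    ∘ₗ ((TensorProduct.assoc k (H ⊗[k] H) (H ⊗[k] H) H).symm).toLinearMap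
    ∘ₗ TensorProduct.map LinearMap.id
        (TensorProduct.map (Coalgebra.comul (R := k)) LinearMap.id)

/-- The mirror bicrossproduct comultiplication on `H ⊗ H`:
`Δ(a ⊗ b) = (a₁ ⊗ S(a₂) a₄ b₂) ⊗ (a₃ ⊗ b₁)`. -/
noncomputable def mirrorComul (H : Type*) [Semiring H] [HopfAlgebra k H] :
    H ⊗[k] H →ₗ[k] (H ⊗[k] H) ⊗[k] (H ⊗[k] H) :=
  TensorProduct.map
      ((TensorProduct.map LinearMap.id (LinearMap.mul' k H))
        ∘ₗ (TensorProduct.assoc k H H H).toLinearMap) LinearMap.id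
    ∘ₗ (TensorProduct.tensorTensorTensorComm k (H ⊗[k] H) H H H).toLinearMap
    ∘ₗ TensorProduct.map ((TensorProduct.assoc k H H H).symm).toLinearMap LinearMap.id
    ∘ₗ TensorProduct.map (TensorProduct.map LinearMap.id (adCoaction k H)) LinearMap.id
    ∘ₗ TensorProduct.map (Coalgebra.comul (R := k))
        ((TensorProduct.comm k H H).toLinearMap ∘ₗ Coalgebra.comul (R := k))

/-- The mirror bicrossproduct counit `a ⊗ b ↦ ε(a)ε(b)`. -/
noncomputable def mirrorCounit (H : Type*) [Semiring H] [HopfAlgebra k H] :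
    H ⊗[k] H →ₗ[k] k :=
  LinearMap.mul' k k ∘ₗ TensorProduct.map (Coalgebra.counit (R := k)) (Coalgebra.counit (R := k))


section Transport

open Coalgebra

variable {k} {V B : Type*} [AddCommMonoid V] [Module k V]

/-- Bialgebra operations on a module that correspond to those of a bialgebra under a linear
equivalence satisfy the bialgebra laws. -/
lemma bialgebra_laws_of_linearEquiv [Semiring B] [Bialgebra k B] (φ : V ≃ₗ[k] B)
    {m : V ⊗[k] V →ₗ[k] V} {u : V} {c : V →ₗ[k] V ⊗[k] V} {e : V →ₗ[k] k}
    (hm : ∀ x y, φ (m (x ⊗ₜ y)) = φ x * φ y) (hu : φ u = 1)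
    (hc : ∀ x, TensorProduct.map φ.toLinearMap φ.toLinearMap (c x) = comul (R := k) (φ x))
    (he : ∀ x, e x = counit (R := k) (φ x)) :
    (∀ x y z, m (m (x ⊗ₜ y) ⊗ₜ z) = m (x ⊗ₜ m (y ⊗ₜ z))) ∧
    (∀ x, m (u ⊗ₜ x) = x) ∧
    (∀ x, m (x ⊗ₜ u) = x) ∧
    (∀ x, TensorProduct.assoc k V V V (TensorProduct.map c LinearMap.id (c x)) =
      TensorProduct.map LinearMap.id c (c x)) ∧
    (∀ x, TensorProduct.lid k V (TensorProduct.map e LinearMap.id (c x)) = x) ∧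
    (∀ x, TensorProduct.rid k V (TensorProduct.map LinearMap.id e (c x)) = x) ∧
    (∀ x y, c (m (x ⊗ₜ y)) =
      TensorProduct.map m m (TensorProduct.tensorTensorTensorComm k V V V V (c x ⊗ₜ c y))) ∧
    c u = u ⊗ₜ u ∧
    (∀ x y, e (m (x ⊗ₜ y)) = e x * e y) ∧
    e u = 1 := by
  have hinj : Function.Injective (TensorProduct.map φ.toLinearMap φ.toLinearMap) :=
    (TensorProduct.congr φ φ).injective
  have hinj₃ : Function.Injective
      (TensorProduct.map φ.toLinearMap (TensorProduct.map φ.toLinearMap φ.toLinearMap)) :=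
    (TensorProduct.congr φ (TensorProduct.congr φ φ)).injective
  have hc' : TensorProduct.map φ.toLinearMap φ.toLinearMap ∘ₗ c = comul ∘ₗ φ.toLinearMap :=
    LinearMap.ext hc
  refine ⟨fun x y z ↦ φ.injective ?_, fun x ↦ φ.injective ?_, fun x ↦ φ.injective ?_,
    fun x ↦ hinj₃ ?_, fun x ↦ φ.injective ?_, fun x ↦ φ.injective ?_, fun x y ↦ hinj ?_,
    hinj ?_, fun x y ↦ ?_, ?_⟩
  · simp only [hm, mul_assoc]
  · rw [hm, hu, one_mul]
  · rw [hm, hu, mul_one]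
  · have hl (t : V ⊗[k] V) :
        TensorProduct.map φ.toLinearMap (TensorProduct.map φ.toLinearMap φ.toLinearMap)
          (TensorProduct.assoc k V V V (TensorProduct.map c LinearMap.id t)) =
        TensorProduct.assoc k B B B (comul.rTensor B
          (TensorProduct.map φ.toLinearMap φ.toLinearMap t)) := by
      induction t with
      | zero => simp only [map_zero]
      | add s t hs ht => simp only [map_add, hs, ht]
      | tmul x y =>
        simp only [TensorProduct.map_tmul, LinearMap.rTensor_tmul, LinearEquiv.coe_coe, ← hc,
          LinearMap.id_apply]
        induction c x with
        | zero => simp only [map_zero, zero_tmul]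
        | add s t hs ht => simp only [map_add, add_tmul, hs, ht]
        | tmul v w => simp
    have hr (t : V ⊗[k] V) :
        TensorProduct.map φ.toLinearMap (TensorProduct.map φ.toLinearMap φ.toLinearMap)
          (TensorProduct.map LinearMap.id c t) =
        comul.lTensor B (TensorProduct.map φ.toLinearMap φ.toLinearMap t) := by
      rw [← LinearMap.comp_apply, ← TensorProduct.map_comp, hc', LinearMap.lTensor,
        ← LinearMap.comp_apply, ← TensorProduct.map_comp]
      rfl
    rw [hl, hr, hc, coassoc_apply]
  · have h (t : V ⊗[k] V) :
        φ (TensorProduct.lid k V (TensorProduct.map e LinearMap.id t)) =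
        TensorProduct.lid k B (counit.rTensor B
          (TensorProduct.map φ.toLinearMap φ.toLinearMap t)) := by
      induction t with
      | zero => simp only [map_zero]
      | add s t hs ht => simp only [map_add, hs, ht]
      | tmul x y => simp [he]
    simp [h, hc]
  · have h (t : V ⊗[k] V) :
        φ (TensorProduct.rid k V (TensorProduct.map LinearMap.id e t)) =
        TensorProduct.rid k B (counit.lTensor B
          (TensorProduct.map φ.toLinearMap φ.toLinearMap t)) := by
      induction t with
      | zero => simp only [map_zero]
      | add s t hs ht => simp only [map_add, hs, ht]
      | tmul x y => simp [he]
    simp [h, hc]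
  · have h (s t : V ⊗[k] V) :
        TensorProduct.map φ.toLinearMap φ.toLinearMap (TensorProduct.map m m
          (TensorProduct.tensorTensorTensorComm k V V V V (s ⊗ₜ t))) =
        TensorProduct.map φ.toLinearMap φ.toLinearMap s *
          TensorProduct.map φ.toLinearMap φ.toLinearMap t := by
      induction s with
      | zero => simp only [map_zero, zero_tmul, zero_mul]
      | add s₁ s₂ h₁ h₂ => simp only [map_add, add_tmul, add_mul, h₁, h₂]
      | tmul x y =>
        induction t with
        | zero => simp only [map_zero, tmul_zero, mul_zero]
        | add t₁ t₂ h₁ h₂ => simp only [map_add, tmul_add, mul_add, h₁, h₂]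
        | tmul z w => simp [hm]
    rw [h, hc, hc, hc, hm, Bialgebra.comul_mul]
  · rw [hc, hu, Bialgebra.comul_one, TensorProduct.map_tmul, LinearEquiv.coe_coe, hu,
      Algebra.TensorProduct.one_def]
  · rw [he, he, he, hm, Bialgebra.counit_mul]
  · rw [he, hu, Bialgebra.counit_one]

/-- The antipode of a Hopf algebra transports along a linear equivalence of modules with
bialgebra operations. -/
lemma antipode_laws_of_linearEquiv [Semiring B] [HopfAlgebra k B] (φ : V ≃ₗ[k] B)
    {m : V ⊗[k] V →ₗ[k] V} {u : V} {c : V →ₗ[k] V ⊗[k] V} {e : V →ₗ[k] k}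
    (hm : ∀ x y, φ (m (x ⊗ₜ y)) = φ x * φ y) (hu : φ u = 1)
    (hc : ∀ x, TensorProduct.map φ.toLinearMap φ.toLinearMap (c x) = comul (R := k) (φ x))
    (he : ∀ x, e x = counit (R := k) (φ x)) :
    ∃ T : V →ₗ[k] V,
      (∀ x, m (TensorProduct.map T LinearMap.id (c x)) = e x • u) ∧
      (∀ x, m (TensorProduct.map LinearMap.id T (c x)) = e x • u) := by
  refine ⟨φ.symm.toLinearMap ∘ₗ HopfAlgebra.antipode k ∘ₗ φ.toLinearMap,
    fun x ↦ φ.injective ?_, fun x ↦ φ.injective ?_⟩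
  · have h (t : V ⊗[k] V) :
        φ (m (TensorProduct.map (φ.symm.toLinearMap ∘ₗ HopfAlgebra.antipode k ∘ₗ φ.toLinearMap)
          LinearMap.id t)) =
        LinearMap.mul' k B ((HopfAlgebra.antipode k).rTensor B
          (TensorProduct.map φ.toLinearMap φ.toLinearMap t)) := by
      induction t with
      | zero => simp only [map_zero]
      | add s t hs ht => simp only [map_add, hs, ht]
      | tmul x y => simp [hm]
    rw [h, hc, HopfAlgebra.mul_antipode_rTensor_comul_apply, map_smul, hu, he,
      Algebra.algebraMap_eq_smul_one]
  · have h (t : V ⊗[k] V) :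
        φ (m (TensorProduct.map LinearMap.id
          (φ.symm.toLinearMap ∘ₗ HopfAlgebra.antipode k ∘ₗ φ.toLinearMap) t)) =
        LinearMap.mul' k B ((HopfAlgebra.antipode k).lTensor B
          (TensorProduct.map φ.toLinearMap φ.toLinearMap t)) := by
      induction t with
      | zero => simp only [map_zero]
      | add s t hs ht => simp only [map_add, hs, ht]
      | tmul x y => simp [hm]
    rw [h, hc, HopfAlgebra.mul_antipode_lTensor_comul_apply, map_smul, hu, he,
      Algebra.algebraMap_eq_smul_one]

end Transport

/-- The co-opposite of a bialgebra: the same algebra, with flipped comultiplication. -/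
def Cop (H : Type*) : Type _ := H

namespace Cop

open Coalgebra

variable {k} (H : Type*) [Semiring H]

instance : Semiring (Cop H) := inferInstanceAs (Semiring H)

instance [Algebra k H] : Algebra k (Cop H) := inferInstanceAs (Algebra k H)

variable (k) in
/-- The identity map from a bialgebra to its co-opposite. -/
def of [Algebra k H] : H ≃ₐ[k] Cop H where
  toFun := id
  invFun := id
  left_inv _ := rfl
  right_inv _ := rfl
  map_mul' _ _ := rfl
  map_add' _ _ := rfl
  commutes' _ := rfl

noncomputable instance [Bialgebra k H] : CoalgebraStruct k (Cop H) where
  comul := (Algebra.TensorProduct.map (of k H : H →ₐ[k] Cop H) (of k H : H →ₐ[k] Cop H)).toLinearMap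
    ∘ₗ (TensorProduct.comm k H H).toLinearMap ∘ₗ comul ∘ₗ (of k H).symm.toLinearMap
  counit := counit ∘ₗ (of k H).symm.toLinearMap

variable {H}

lemma comul_of [Bialgebra k H] (h : H) : comul (R := k) (of k H h) =
    Algebra.TensorProduct.map (of k H : H →ₐ[k] Cop H) (of k H : H →ₐ[k] Cop H)
      (TensorProduct.comm k H H (comul h)) := rfl

@[simp]
lemma counit_of [Bialgebra k H] (h : H) : counit (R := k) (of k H h) = counit (R := k) h := rfl

noncomputable instance [Bialgebra k H] : Bialgebra k (Cop H) :=
  letI : Coalgebra k (Cop H) :=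
    { coassoc := by
        ext x
        obtain ⟨h, rfl⟩ := (of k H).surjective x
        let F : H ⊗[k] (H ⊗[k] H) →ₗ[k] Cop H ⊗[k] (Cop H ⊗[k] Cop H) :=
          TensorProduct.map (of k H).toLinearMap
            (TensorProduct.map (of k H).toLinearMap (of k H).toLinearMap)
          ∘ₗ (TensorProduct.assoc k H H H).toLinearMap
          ∘ₗ (TensorProduct.comm k H (H ⊗[k] H)).toLinearMap
          ∘ₗ (TensorProduct.comm k H H).toLinearMap.lTensor H
        convert congr(F $((coassoc_apply (R := k) h).symm)) using 1
        · simp only [LinearMap.comp_apply, comul_of, LinearEquiv.coe_coe]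
          induction comul (R := k) h with
          | zero => simp only [map_zero]
          | add s t hs ht => simp only [map_add, hs, ht]
          | tmul x y =>
            simp only [TensorProduct.comm_tmul, Algebra.TensorProduct.map_tmul,
              LinearMap.rTensor_tmul, LinearMap.lTensor_tmul, AlgEquiv.coe_toAlgHom, comul_of]
            induction comul (R := k) y with
            | zero => simp only [map_zero, zero_tmul, tmul_zero]
            | add s t hs ht => simp only [map_add, add_tmul, tmul_add, hs, ht]
            | tmul z w => simp [F]
        · simp only [LinearMap.comp_apply, comul_of]
          induction comul (R := k) h with
          | zero => simp only [map_zero]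
          | add s t hs ht => simp only [map_add, hs, ht]
          | tmul x y =>
            simp only [TensorProduct.comm_tmul, Algebra.TensorProduct.map_tmul,
              LinearMap.rTensor_tmul, LinearMap.lTensor_tmul, AlgEquiv.coe_toAlgHom, comul_of]
            induction comul (R := k) x with
            | zero => simp only [map_zero, zero_tmul, tmul_zero]
            | add s t hs ht => simp only [map_add, add_tmul, tmul_add, hs, ht]
            | tmul z w => simp [F]
      rTensor_counit_comp_comul := by
        ext x
        obtain ⟨h, rfl⟩ := (of k H).surjective x
        convert congr(TensorProduct.map LinearMap.id (of k H).toLinearMap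
          (TensorProduct.comm k H k $(lTensor_counit_comul (R := k) h))) using 1
        · simp only [LinearMap.comp_apply, comul_of]
          induction comul (R := k) h with
          | zero => simp only [map_zero]
          | add s t hs ht => simp only [map_add, hs, ht]
          | tmul x y => simp
        · simp
      lTensor_counit_comp_comul := by
        ext x
        obtain ⟨h, rfl⟩ := (of k H).surjective x
        convert congr(TensorProduct.map (of k H).toLinearMap LinearMap.id
          (TensorProduct.comm k k H $(rTensor_counit_comul (R := k) h))) using 1
        · simp only [LinearMap.comp_apply, comul_of]
          induction comul (R := k) h with
          | zero => simp only [map_zero]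
          | add s t hs ht => simp only [map_add, hs, ht]
          | tmul x y => simp
        · simp }
  Bialgebra.mk' k (Cop H) (Bialgebra.counit_one (R := k) (A := H))
    (fun {a b} ↦ Bialgebra.counit_mul (R := k) (A := H) a b)
    (by
      change comul (R := k) (of k H 1) = _
      rw [comul_of, Bialgebra.comul_one, Algebra.TensorProduct.one_def]
      simp [Algebra.TensorProduct.one_def])
    (fun {a b} ↦ by
      change comul (R := k) (of k H ((of k H).symm a * (of k H).symm b)) =
        comul (R := k) (of k H ((of k H).symm a)) * comul (R := k) (of k H ((of k H).symm b))
      have h (s t : H ⊗[k] H) : TensorProduct.comm k H H (s * t) =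
          TensorProduct.comm k H H s * TensorProduct.comm k H H t :=
        map_mul (Algebra.TensorProduct.comm k H H) s t
      rw [comul_of, comul_of, comul_of, Bialgebra.comul_mul, h, map_mul])

/-- The co-opposite of a Hopf algebra with bijective antipode is a Hopf algebra, with the inverse
antipode. -/
noncomputable abbrev hopfAlgebra [HopfAlgebra k H]
    (hS : Function.Bijective (HopfAlgebra.antipode k (A := H))) : HopfAlgebra k (Cop H) :=
  let S := LinearEquiv.ofBijective _ hS
  let T := (of k H).toLinearMap ∘ₗ S.symm.toLinearMap ∘ₗ (of k H).symm.toLinearMap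
  have hT (x : H) : HopfAlgebra.antipode k ((of k H).symm (T (of k H x))) = x :=
    S.apply_symm_apply x
  { antipode := T
    mul_antipode_rTensor_comul := by
      ext x
      obtain ⟨h, rfl⟩ := (of k H).surjective x
      refine (of k H).symm.injective (hS.injective ?_)
      convert HopfAlgebra.mul_antipode_rTensor_comul_apply (R := k) h using 1
      · simp only [LinearMap.comp_apply, comul_of]
        induction comul (R := k) h with
        | zero => simp only [map_zero]
        | add s t hs ht => simp only [map_add, hs, ht]
        | tmul x y => simp [HopfAlgebra.antipode_mul_antidistrib, hT]
      · simp [Algebra.algebraMap_eq_smul_one]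
    mul_antipode_lTensor_comul := by
      ext x
      obtain ⟨h, rfl⟩ := (of k H).surjective x
      refine (of k H).symm.injective (hS.injective ?_)
      convert HopfAlgebra.mul_antipode_lTensor_comul_apply (R := k) h using 1
      · simp only [LinearMap.comp_apply, comul_of]
        induction comul (R := k) h with
        | zero => simp only [map_zero]
        | add s t hs ht => simp only [map_add, hs, ht]
        | tmul x y => simp [HopfAlgebra.antipode_mul_antidistrib, hT]
      · simp [Algebra.algebraMap_eq_smul_one] }

end Cop

namespace MirrorBicrossproduct

open Coalgebra WithConv

variable (H : Type*) [Semiring H] [HopfAlgebra k H]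

/-- The inclusion `a ↦ a ⊗ 1` of the first factor. -/
noncomputable abbrev inl : H →ₐ[k] H ⊗[k] Cop H := Algebra.TensorProduct.includeLeft

/-- The inclusion `b ↦ 1 ⊗ b` of the second factor. -/
noncomputable abbrev inr : H →ₐ[k] H ⊗[k] Cop H :=
  Algebra.TensorProduct.includeRight.comp (Cop.of k H : H →ₐ[k] Cop H)

/-- The comultiplication as an algebra map `H → H ⊗ H_cop`, which is the convolution product of the
two inclusions. -/
noncomputable abbrev diag : H →ₐ[k] H ⊗[k] Cop H :=
  (Algebra.TensorProduct.map (.id k H) (Cop.of k H : H →ₐ[k] Cop H)).comp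
    (Bialgebra.comulAlgHom k H)

variable {k H}

lemma toConv_diag : toConv (diag k H).toLinearMap =
    toConv (inl k H).toLinearMap * toConv (inr k H).toLinearMap := by
  ext a
  simp only [LinearMap.convMul_apply]
  change Algebra.TensorProduct.map _ _ (comul (R := k) a) = _
  induction comul (R := k) a with
  | zero => simp only [map_zero]
  | add s t hs ht => simp only [map_add, hs, ht]
  | tmul x y => simp

lemma algHom_comp_toConv_mul {A B C : Type*} [Semiring A] [Algebra k A] [Semiring B] [Algebra k B]
    [AddCommMonoid C] [Module k C] [Coalgebra k C] (h : A →ₐ[k] B)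
    (f g : WithConv (C →ₗ[k] A)) :
    toConv (h.toLinearMap ∘ₗ (f * g).ofConv) =
      toConv (h.toLinearMap ∘ₗ f.ofConv) * toConv (h.toLinearMap ∘ₗ g.ofConv) :=
  congrArg toConv (LinearMap.algHom_comp_convMul_distrib h f g)

lemma toConv_algHom_mul_antipode {B : Type*} [Semiring B] [Algebra k B] (h : H →ₐ[k] B) :
    toConv h.toLinearMap * toConv (h.toLinearMap ∘ₗ HopfAlgebra.antipode k) = 1 := by
  have := algHom_comp_toConv_mul h (toConv LinearMap.id) (toConv (HopfAlgebra.antipode k))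
  rw [LinearMap.id_mul_antipode] at this
  refine this.symm.trans ?_
  ext x
  simp

lemma toConv_antipode_mul_algHom {B : Type*} [Semiring B] [Algebra k B] (h : H →ₐ[k] B) :
    toConv (h.toLinearMap ∘ₗ HopfAlgebra.antipode k) * toConv h.toLinearMap = 1 := by
  have := algHom_comp_toConv_mul h (toConv (HopfAlgebra.antipode k)) (toConv LinearMap.id)
  rw [LinearMap.antipode_mul_id] at this
  refine this.symm.trans ?_
  ext x
  simp

/-- The right `H_cop`-linear endomorphism `a ⊗ b ↦ f a * (1 ⊗ b)`. -/
noncomputable def extendRight (f : H →ₗ[k] H ⊗[k] Cop H) : H ⊗[k] Cop H →ₗ[k] H ⊗[k] Cop H :=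
  LinearMap.mul' k (H ⊗[k] Cop H) ∘ₗ
    TensorProduct.map f Algebra.TensorProduct.includeRight.toLinearMap

lemma extendRight_tmul (f : H →ₗ[k] H ⊗[k] Cop H) (a b : H) :
    extendRight f (a ⊗ₜ Cop.of k H b) = f a * inr k H b := rfl

lemma extendRight_mul_inr (f : H →ₗ[k] H ⊗[k] Cop H) (x : H ⊗[k] Cop H) (b : H) :
    extendRight f (x * inr k H b) = extendRight f x * inr k H b := by
  induction x with
  | zero => simp only [map_zero, zero_mul]
  | add x y hx hy => simp only [map_add, add_mul, hx, hy]
  | tmul a c => simp [extendRight, mul_assoc]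

lemma extendRight_inl : extendRight (inl k H).toLinearMap = LinearMap.id := by
  ext a b
  simp [extendRight]

lemma extendRight_comp_extendRight (f g : H →ₗ[k] H ⊗[k] Cop H) :
    extendRight f ∘ₗ extendRight g = extendRight (extendRight f ∘ₗ g) := by
  ext a b
  obtain ⟨b, rfl⟩ := (Cop.of k H).surjective b
  exact extendRight_mul_inr f (g a) b

lemma extendRight_comp_inl_mul_inr (f : H →ₗ[k] H ⊗[k] Cop H) (g : H →ₗ[k] H) :
    extendRight f ∘ₗ
        (toConv (inl k H).toLinearMap * toConv ((inr k H).toLinearMap ∘ₗ g)).ofConv =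
      (toConv f * toConv ((inr k H).toLinearMap ∘ₗ g)).ofConv := by
  ext a
  simp only [LinearMap.comp_apply, LinearMap.convMul_apply]
  induction comul (R := k) a with
  | zero => simp only [map_zero]
  | add s t hs ht => simp only [map_add, hs, ht]
  | tmul x y => simp [extendRight]

/-- The linear automorphism `a ⊗ b ↦ a₁ ⊗ a₂ b`, with inverse `a ⊗ b ↦ a₁ ⊗ S(a₂) b`. -/
noncomputable def untwist : (H ⊗[k] Cop H) ≃ₗ[k] H ⊗[k] Cop H :=
  .ofLinearMap (extendRight (diag k H).toLinearMap)
    (extendRight (toConv (inl k H).toLinearMap *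
      toConv ((inr k H).toLinearMap ∘ₗ HopfAlgebra.antipode k)).ofConv)
    (by
      rw [extendRight_comp_extendRight, extendRight_comp_inl_mul_inr, toConv_diag, mul_assoc,
        toConv_algHom_mul_antipode, mul_one, ofConv_toConv, extendRight_inl])
    (by
      have h := extendRight_comp_inl_mul_inr (k := k) (toConv (inl k H).toLinearMap *
        toConv ((inr k H).toLinearMap ∘ₗ HopfAlgebra.antipode k)).ofConv LinearMap.id
      rw [LinearMap.comp_id, ← toConv_diag, ofConv_toConv, toConv_ofConv, mul_assoc,
        toConv_antipode_mul_algHom, mul_one, ofConv_toConv] at h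
      rw [extendRight_comp_extendRight, h, extendRight_inl])

variable (k H) in
/-- The linear isomorphism `a ⊗ b ↦ a₁ ⊗ a₂ b`, which identifies the mirror bicrossproduct with the
tensor product Hopf algebra `H ⊗ H_cop`. -/
noncomputable def toTensorCop : (H ⊗[k] H) ≃ₗ[k] H ⊗[k] Cop H :=
  TensorProduct.congr (.refl k H) (Cop.of k H).toLinearEquiv ≪≫ₗ untwist

lemma toTensorCop_tmul (a b : H) : toTensorCop k H (a ⊗ₜ b) = diag k H a * inr k H b := rfl

lemma toTensorCop_one : toTensorCop k H (1 ⊗ₜ 1) = 1 := by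
  rw [toTensorCop_tmul, map_one, map_one, mul_one]

lemma toConv_adAction (b : H) : toConv (adAction k H ∘ₗ TensorProduct.mk k H H b) =
    toConv (HopfAlgebra.antipode k) * toConv (LinearMap.mulLeft k b) := by
  ext h
  simp only [LinearMap.convMul_apply, adAction, LinearMap.comp_apply, TensorProduct.mk_apply,
    LinearEquiv.coe_coe, TensorProduct.comm_tmul, TensorProduct.map_tmul, LinearMap.id_apply]
  induction comul (R := k) h with
  | zero => simp only [map_zero, zero_tmul]
  | add s t hs ht => simp only [map_add, add_tmul, hs, ht]
  | tmul x y => simp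

lemma diag_mul_adAction (b : H) : toConv (diag k H).toLinearMap *
      toConv ((inr k H).toLinearMap ∘ₗ adAction k H ∘ₗ TensorProduct.mk k H H b) =
    toConv (LinearMap.mulLeft k (inr k H b) ∘ₗ (diag k H).toLinearMap) := by
  have h := algHom_comp_toConv_mul (inr k H) (toConv (HopfAlgebra.antipode k))
    (toConv (LinearMap.mulLeft k b))
  rw [← toConv_adAction] at h
  rw [h, toConv_diag, mul_assoc, ← mul_assoc (toConv (inr k H).toLinearMap),
    toConv_algHom_mul_antipode, one_mul, ← ofConv_toConv (diag k H).toLinearMap, toConv_diag]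
  ext a
  simp only [LinearMap.convMul_apply, LinearMap.comp_apply]
  induction comul (R := k) a with
  | zero => simp only [map_zero]
  | add s t hs ht => simp only [map_add, hs, ht]
  | tmul x y => simp

lemma toTensorCop_mirrorMul (x y : H ⊗[k] H) :
    toTensorCop k H (mirrorMul k H (x ⊗ₜ y)) = toTensorCop k H x * toTensorCop k H y := by
  induction x with
  | zero => simp only [map_zero, zero_tmul, zero_mul]
  | add x₁ x₂ h₁ h₂ => simp only [map_add, add_tmul, add_mul, h₁, h₂]
  | tmul a b =>
    induction y with
    | zero => simp only [map_zero, tmul_zero, mul_zero]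
    | add y₁ y₂ h₁ h₂ => simp only [map_add, tmul_add, mul_add, h₁, h₂]
    | tmul a' b' =>
      have key := LinearMap.congr_fun (congrArg ofConv (diag_mul_adAction (k := k) b)) a'
      trans diag k H a * LinearMap.mul' k (H ⊗[k] Cop H) (TensorProduct.map (diag k H).toLinearMap
        ((inr k H).toLinearMap ∘ₗ adAction k H ∘ₗ TensorProduct.mk k H H b) (comul a')) *
          inr k H b'
      · simp only [mirrorMul, LinearMap.comp_apply, TensorProduct.map_tmul, LinearMap.id_apply]
        induction comul (R := k) a' with
        | zero => simp only [map_zero, zero_tmul, tmul_zero, mul_zero, zero_mul]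
        | add s t hs ht => simp only [map_add, add_tmul, tmul_add, mul_add, add_mul, hs, ht]
        | tmul z w =>
          simp only [LinearEquiv.coe_coe, TensorProduct.assoc_symm_tmul, TensorProduct.map_tmul,
            TensorProduct.tensorTensorTensorComm_tmul, LinearMap.id_apply, LinearMap.comp_apply,
            TensorProduct.assoc_tmul, LinearMap.mul'_apply, toTensorCop_tmul, map_mul, mul_assoc,
            AlgHom.toLinearMap_apply, TensorProduct.mk_apply]
      · rw [toTensorCop_tmul, toTensorCop_tmul, mul_assoc, mul_assoc, ← mul_assoc (inr k H b)]
        congr 2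

lemma toConv_adCoaction : toConv (adCoaction k H) =
    toConv ((Algebra.TensorProduct.includeLeft : H →ₐ[k] H ⊗[k] H).toLinearMap ∘ₗ
      HopfAlgebra.antipode k) *
    toConv ((TensorProduct.comm k H H).toLinearMap ∘ₗ comul) := by
  ext h
  simp only [LinearMap.convMul_apply, adCoaction, LinearMap.comp_apply]
  trans TensorProduct.map (LinearMap.mul' k H) LinearMap.id
    ((TensorProduct.assoc k H H H).symm
      (TensorProduct.map (HopfAlgebra.antipode k) (TensorProduct.comm k H H).toLinearMap
        (comul.lTensor H (comul h))))
  · rw [← coassoc_apply]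
    change _ = TensorProduct.map _ _ ((TensorProduct.assoc k H H H).symm
      (TensorProduct.map _ _ (TensorProduct.assoc k H H H
        (TensorProduct.map comul LinearMap.id (comul h)))))
    induction TensorProduct.map comul LinearMap.id (comul (R := k) h) with
    | zero => simp only [map_zero]
    | add s t hs ht => simp only [map_add, hs, ht]
    | tmul x y =>
      induction x with
      | zero => simp only [map_zero, zero_tmul]
      | add s t hs ht => simp only [map_add, add_tmul, hs, ht]
      | tmul z w => simp
  · induction comul (R := k) h with
    | zero => simp only [map_zero]
    | add s t hs ht => simp only [map_add, hs, ht]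
    | tmul x y =>
      simp only [LinearMap.lTensor_tmul, TensorProduct.map_tmul, LinearMap.comp_apply]
      induction comul (R := k) y with
      | zero => simp only [map_zero, tmul_zero]
      | add s t hs ht => simp only [map_add, tmul_add, hs, ht]
      | tmul z w => simp

lemma includeLeft_mul_adCoaction :
    toConv (Algebra.TensorProduct.includeLeft : H →ₐ[k] H ⊗[k] H).toLinearMap *
      toConv (adCoaction k H) = toConv ((TensorProduct.comm k H H).toLinearMap ∘ₗ comul) := by
  rw [toConv_adCoaction, ← mul_assoc, toConv_algHom_mul_antipode, one_mul]

variable (k H) in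
/-- The inclusion of the first copy of `H ⊗ H_cop` into its tensor square. -/
noncomputable abbrev squareInl :
    H ⊗[k] Cop H →ₐ[k] (H ⊗[k] Cop H) ⊗[k] (H ⊗[k] Cop H) :=
  Algebra.TensorProduct.includeLeft

variable (k H) in
/-- The inclusion of the second copy of `H ⊗ H_cop` into its tensor square. -/
noncomputable abbrev squareInr :
    H ⊗[k] Cop H →ₐ[k] (H ⊗[k] Cop H) ⊗[k] (H ⊗[k] Cop H) :=
  Algebra.TensorProduct.includeRight

lemma comul_comp_inl :
    toConv ((Bialgebra.comulAlgHom k (H ⊗[k] Cop H)).comp (inl k H)).toLinearMap =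
    toConv ((squareInl k H).comp (inl k H)).toLinearMap *
      toConv ((squareInr k H).comp (inl k H)).toLinearMap := by
  ext a
  simp only [LinearMap.convMul_apply]
  change comul (R := k) (a ⊗ₜ[k] (1 : Cop H)) = _
  rw [TensorProduct.comul_tmul, Bialgebra.comul_one, Algebra.TensorProduct.one_def]
  induction comul (R := k) a with
  | zero => simp only [map_zero, zero_tmul]
  | add s t hs ht => simp only [map_add, add_tmul, hs, ht]
  | tmul x y => simp [Algebra.TensorProduct.one_def]

lemma comul_inr (b : H) : comul (R := k) (inr k H b) =
    TensorProduct.map (inr k H).toLinearMap (inr k H).toLinearMap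
      (TensorProduct.comm k H H (comul b)) := by
  change comul (R := k) ((1 : H) ⊗ₜ[k] Cop.of k H b) = _
  rw [TensorProduct.comul_tmul, Bialgebra.comul_one, Algebra.TensorProduct.one_def, Cop.comul_of]
  induction comul (R := k) b with
  | zero => simp only [map_zero, tmul_zero]
  | add s t hs ht => simp only [map_add, tmul_add, hs, ht]
  | tmul x y => simp

lemma comul_comp_inr :
    toConv ((Bialgebra.comulAlgHom k (H ⊗[k] Cop H)).comp (inr k H)).toLinearMap =
    toConv ((squareInr k H).comp (inr k H)).toLinearMap *
      toConv ((squareInl k H).comp (inr k H)).toLinearMap := by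
  ext a
  simp only [LinearMap.convMul_apply]
  refine (comul_inr a).trans ?_
  induction comul (R := k) a with
  | zero => simp only [map_zero]
  | add s t hs ht => simp only [map_add, hs, ht]
  | tmul x y => simp

lemma map_inr_diag_comp_comm_comul :
    toConv ((Algebra.TensorProduct.map (inr k H) (diag k H)).toLinearMap ∘ₗ
      (TensorProduct.comm k H H).toLinearMap ∘ₗ comul) =
    toConv ((squareInr k H).comp (diag k H)).toLinearMap *
      toConv ((squareInl k H).comp (inr k H)).toLinearMap := by
  ext a
  simp only [LinearMap.convMul_apply, LinearMap.comp_apply]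
  induction comul (R := k) a with
  | zero => simp only [map_zero]
  | add s t hs ht => simp only [map_add, hs, ht]
  | tmul x y => simp

lemma algHom_comp_diag {B : Type*} [Semiring B] [Algebra k B] (h : H ⊗[k] Cop H →ₐ[k] B) :
    toConv (h.comp (diag k H)).toLinearMap =
      toConv (h.comp (inl k H)).toLinearMap * toConv (h.comp (inr k H)).toLinearMap := by
  have := algHom_comp_toConv_mul h (toConv (inl k H).toLinearMap) (toConv (inr k H).toLinearMap)
  rwa [← toConv_diag] at this

lemma squareInl_diag_mul_adCoaction :
    toConv ((squareInl k H).comp (diag k H)).toLinearMap *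
      toConv ((Algebra.TensorProduct.map (inr k H) (diag k H)).toLinearMap ∘ₗ adCoaction k H) =
    toConv ((Bialgebra.comulAlgHom k (H ⊗[k] Cop H)).comp (diag k H)).toLinearMap := by
  have h := algHom_comp_toConv_mul (Algebra.TensorProduct.map (inr k H) (diag k H))
    (toConv (Algebra.TensorProduct.includeLeft : H →ₐ[k] H ⊗[k] H).toLinearMap)
    (toConv (adCoaction k H))
  rw [includeLeft_mul_adCoaction] at h
  have h' : (Algebra.TensorProduct.map (inr k H) (diag k H)).toLinearMap ∘ₗ
      (Algebra.TensorProduct.includeLeft : H →ₐ[k] H ⊗[k] H).toLinearMap =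
      ((squareInl k H).comp (inr k H)).toLinearMap := by
    ext x
    change Algebra.TensorProduct.map (inr k H) (diag k H) (x ⊗ₜ[k] 1) = inr k H x ⊗ₜ[k] 1
    rw [Algebra.TensorProduct.map_tmul, map_one]
  simp only at h
  rw [h', map_inr_diag_comp_comm_comul] at h
  rw [algHom_comp_diag, mul_assoc, ← h, algHom_comp_diag, algHom_comp_diag, comul_comp_inl,
    comul_comp_inr]
  simp only [mul_assoc]

lemma map_toTensorCop_mirrorComul (x : H ⊗[k] H) :
    TensorProduct.map (toTensorCop k H).toLinearMap (toTensorCop k H).toLinearMap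
      (mirrorComul k H x) = comul (R := k) (toTensorCop k H x) := by
  induction x with
  | zero => simp only [map_zero]
  | add x y hx hy => simp only [map_add, hx, hy]
  | tmul a b =>
    have key := LinearMap.congr_fun (congrArg ofConv (squareInl_diag_mul_adCoaction (k := k))) a
    change LinearMap.mul' k _ (TensorProduct.map _ _ (comul a)) =
      comul (R := k) (diag k H a) at key
    rw [toTensorCop_tmul, Bialgebra.comul_mul, comul_inr, ← key]
    simp only [mirrorComul, LinearMap.comp_apply, TensorProduct.map_tmul, LinearEquiv.coe_coe]
    induction comul (R := k) a with
    | zero => simp only [map_zero, zero_tmul, zero_mul]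
    | add s t hs ht => simp only [map_add, add_tmul, add_mul, hs, ht]
    | tmul z w =>
      simp only [TensorProduct.map_tmul, LinearMap.comp_apply, LinearMap.mul'_apply]
      induction adCoaction k H w with
      | zero => simp only [map_zero, zero_tmul, tmul_zero, mul_zero, zero_mul]
      | add s t hs ht => simp only [map_add, add_tmul, tmul_add, mul_add, add_mul, hs, ht]
      | tmul u v =>
        induction TensorProduct.comm k H H (comul (R := k) b) with
        | zero => simp only [map_zero, tmul_zero, mul_zero]
        | add s t hs ht => simp only [map_add, tmul_add, mul_add, hs, ht]
        | tmul p q =>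
          change (diag k H z * inr k H (u * p)) ⊗ₜ[k] (diag k H v * inr k H q) =
            ((diag k H z ⊗ₜ[k] 1) * (inr k H u ⊗ₜ[k] diag k H v)) *
              (inr k H p ⊗ₜ[k] inr k H q)
          rw [Algebra.TensorProduct.tmul_mul_tmul, Algebra.TensorProduct.tmul_mul_tmul, one_mul,
            map_mul, mul_assoc]

lemma mirrorCounit_eq (x : H ⊗[k] H) :
    mirrorCounit k H x = counit (R := k) (toTensorCop k H x) := by
  induction x with
  | zero => simp only [map_zero]
  | add x y hx hy => simp only [map_add, hx, hy]
  | tmul a b =>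
    have h₁ : toConv ((Bialgebra.counitAlgHom k (H ⊗[k] Cop H)).comp (inl k H)).toLinearMap =
        1 := by
      ext x
      simp
    have h₂ : toConv ((Bialgebra.counitAlgHom k (H ⊗[k] Cop H)).comp (inr k H)).toLinearMap =
        1 := by
      ext x
      simp
    have h := algHom_comp_diag (Bialgebra.counitAlgHom k (H ⊗[k] Cop H))
    rw [h₁, h₂, mul_one] at h
    have ha : counit (R := k) (diag k H a) = counit (R := k) a :=
      LinearMap.congr_fun (congrArg ofConv h) a
    rw [toTensorCop_tmul, Bialgebra.counit_mul, ha]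
    simp [mirrorCounit]

end MirrorBicrossproduct

theorem mirror_bicrossproduct_hopf
    {H : Type*} [Semiring H] [HopfAlgebra k H]
    (hS : Function.Bijective (HopfAlgebra.antipode (R := k) (A := H))) :
    -- the product is associative
    (∀ x y z : H ⊗[k] H,
      mirrorMul k H (mirrorMul k H (x ⊗ₜ y) ⊗ₜ z) = mirrorMul k H (x ⊗ₜ mirrorMul k H (y ⊗ₜ z))) ∧
    -- 1 ⊗ 1 is a two-sided unit
    (∀ x : H ⊗[k] H, mirrorMul k H (((1 : H) ⊗ₜ (1 : H)) ⊗ₜ x) = x) ∧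
    (∀ x : H ⊗[k] H, mirrorMul k H (x ⊗ₜ ((1 : H) ⊗ₜ (1 : H))) = x) ∧
    -- the coproduct is coassociative
    (∀ x : H ⊗[k] H,
      (TensorProduct.assoc k (H ⊗[k] H) (H ⊗[k] H) (H ⊗[k] H))
        (TensorProduct.map (mirrorComul k H) LinearMap.id (mirrorComul k H x)) =
      TensorProduct.map LinearMap.id (mirrorComul k H) (mirrorComul k H x)) ∧
    -- the counit is a two-sided counit
    (∀ x : H ⊗[k] H, (TensorProduct.lid k (H ⊗[k] H))
      (TensorProduct.map (mirrorCounit k H) LinearMap.id (mirrorComul k H x)) = x) ∧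
    (∀ x : H ⊗[k] H, (TensorProduct.rid k (H ⊗[k] H))
      (TensorProduct.map LinearMap.id (mirrorCounit k H) (mirrorComul k H x)) = x) ∧
    -- the coproduct is a unital algebra map (w.r.t. the factorwise product)
    (∀ x y : H ⊗[k] H, mirrorComul k H (mirrorMul k H (x ⊗ₜ y)) =
      TensorProduct.map (mirrorMul k H) (mirrorMul k H)
        (TensorProduct.tensorTensorTensorComm k (H ⊗[k] H) (H ⊗[k] H) (H ⊗[k] H) (H ⊗[k] H)
          (mirrorComul k H x ⊗ₜ mirrorComul k H y))) ∧
    (mirrorComul k H ((1 : H) ⊗ₜ (1 : H)) =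
      ((1 : H) ⊗ₜ (1 : H)) ⊗ₜ[k] ((1 : H) ⊗ₜ (1 : H))) ∧
    -- the counit is a unital algebra map
    (∀ x y : H ⊗[k] H, mirrorCounit k H (mirrorMul k H (x ⊗ₜ y)) =
      mirrorCounit k H x * mirrorCounit k H y) ∧
    (mirrorCounit k H ((1 : H) ⊗ₜ (1 : H)) = 1) ∧
    -- the bialgebra admits an antipode, hence is a Hopf algebra
    (∃ T : H ⊗[k] H →ₗ[k] H ⊗[k] H,
      (∀ x : H ⊗[k] H, mirrorMul k H
          ((TensorProduct.map T LinearMap.id) (mirrorComul k H x)) =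
        mirrorCounit k H x • ((1 : H) ⊗ₜ (1 : H))) ∧
      (∀ x : H ⊗[k] H, mirrorMul k H
          ((TensorProduct.map LinearMap.id T) (mirrorComul k H x)) =
        mirrorCounit k H x • ((1 : H) ⊗ₜ (1 : H)))) := by
  open MirrorBicrossproduct in
  obtain ⟨h₁, h₂, h₃, h₄, h₅, h₆, h₇, h₈, h₉, h₁₀⟩ :=
    bialgebra_laws_of_linearEquiv (toTensorCop k H) toTensorCop_mirrorMul toTensorCop_one
      map_toTensorCop_mirrorComul mirrorCounit_eq
  refine ⟨h₁, h₂, h₃, h₄, h₅, h₆, h₇, h₈, h₉, h₁₀, ?_⟩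
  let : HopfAlgebra k (Cop H) := Cop.hopfAlgebra hS
  open MirrorBicrossproduct in
  exact antipode_laws_of_linearEquiv (toTensorCop k H) toTensorCop_mirrorMul toTensorCop_one
    map_toTensorCop_mirrorComul mirrorCounit_eq
end

section
/- Let H be a Hopf algebra over a field k with bijective antipode S, and equip H ⊗ H with the mirror bicrossproduct product (a ⊗ b)(a' ⊗ b') = a a'₁ ⊗ S(a'₂) b a'₃ b'. Then the maps s(g) := 1 ⊗ g and t(g) := S⁻¹(g₂) ⊗ g₁ satisfy, for all g, g' ∈ H: t(g) t(g') = t(g' g) (so t is an algebra map from H^op_cop... i.e. reverses the product of H), and s(g') t(g) = t(g) s(g') (the ranges of s and t commute). -/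
/-!
STATEMENT 13: For a Hopf algebra H with bijective antipode S (with linear inverse Sinv = S⁻¹),
on the mirror bicrossproduct H ⊗ H with product (a ⊗ b)(a' ⊗ b') = a a'₁ ⊗ S(a'₂) b a'₃ b',
the maps s(g) := 1 ⊗ g and t(g) := S⁻¹(g₂) ⊗ g₁ satisfy t(g) t(g') = t(g' g) and
s(g') t(g) = t(g) s(g'). -/

open TensorProduct

variable (k : Type*) [Field k]

/-- The target map `t(g) = S⁻¹(g₂) ⊗ g₁`. -/
noncomputable def mirrorTarget (H : Type*) [Semiring H] [HopfAlgebra k H]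
    (Sinv : H →ₗ[k] H) : H →ₗ[k] H ⊗[k] H :=
  TensorProduct.map Sinv LinearMap.id
    ∘ₗ (TensorProduct.comm k H H).toLinearMap ∘ₗ Coalgebra.comul (R := k)

namespace HopfAlgebra

open Coalgebra LinearMap WithConv

variable {k} {H : Type*} [Semiring H] [HopfAlgebra k H]

lemma sum_antipode_tmul_one_mul_comul (x : H) :
    ∑ i ∈ (ℛ k x).index, (antipode k ((ℛ k x).left i) ⊗ₜ[k] (1 : H)) * comul ((ℛ k x).right i) =
      (1 : H) ⊗ₜ[k] x := by
  have h := congr(TensorProduct.map (mul' k H ∘ₗ (antipode k).rTensor H) LinearMap.id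
    ((TensorProduct.assoc k H H H).symm $(sum_tmul_tmul_eq (ℛ k x)
      (fun i ↦ ℛ k ((ℛ k x).left i)) (fun i ↦ ℛ k ((ℛ k x).right i)))))
  simp only [map_sum, TensorProduct.assoc_symm_tmul, TensorProduct.map_tmul, LinearMap.comp_apply,
    LinearMap.rTensor_tmul, mul'_apply, LinearMap.id_apply, ← TensorProduct.sum_tmul,
    sum_antipode_mul_eq_smul] at h
  simp only [TensorProduct.smul_tmul, ← TensorProduct.tmul_sum, sum_counit_smul] at h
  rw [h]
  refine Finset.sum_congr rfl fun i _ ↦ ?_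
  simp [← (ℛ k ((ℛ k x).right i)).eq, Finset.mul_sum]

lemma map_antipode_comm_comul_convMul_comul :
    toConv (TensorProduct.map (antipode k) (antipode k) ∘ₗ
      (TensorProduct.comm k H H).toLinearMap ∘ₗ comul) * toConv (comul (R := k) (A := H)) = 1 := by
  ext x
  let F : H ⊗[k] (H ⊗[k] H) →ₗ[k] H ⊗[k] H :=
    mul' k (H ⊗[k] H) ∘ₗ TensorProduct.map (TensorProduct.map (antipode k) (antipode k) ∘ₗ
      (TensorProduct.comm k H H).toLinearMap) comul ∘ₗ (TensorProduct.assoc k H H H).symm.toLinearMap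
  have hF (a b c : H) : F (a ⊗ₜ (b ⊗ₜ c)) =
      ((1 : H) ⊗ₜ[k] antipode k a) * ((antipode k b ⊗ₜ[k] (1 : H)) * comul c) := by
    simp [F, ← mul_assoc]
  have h := congr(F $(sum_tmul_tmul_eq (ℛ k x)
      (fun i ↦ ℛ k ((ℛ k x).left i)) (fun i ↦ ℛ k ((ℛ k x).right i))))
  simp only [map_sum, hF, ← Finset.mul_sum, sum_antipode_tmul_one_mul_comul] at h
  simp only [Algebra.TensorProduct.tmul_mul_tmul, one_mul, ← TensorProduct.tmul_sum,
    sum_antipode_mul_eq_smul] at h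
  rw [(ℛ k x).convMul_apply]
  trans (1 : H) ⊗ₜ[k] (counit (R := k) x • (1 : H))
  · rw [← h]
    refine Finset.sum_congr rfl fun i _ ↦ ?_
    simp [← (ℛ k ((ℛ k x).left i)).eq, Finset.sum_mul, ← mul_assoc]
  · simp [Algebra.algebraMap_eq_smul_one, Algebra.TensorProduct.one_def]

/-- The antipode reverses the comultiplication. -/
lemma comul_antipode (x : H) :
    comul (R := k) (antipode k x) =
      TensorProduct.map (antipode k) (antipode k) (TensorProduct.comm k H H (comul x)) :=
  congr(ofConv $(left_inv_eq_right_inv map_antipode_comm_comul_convMul_comul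
    (comul_right_inv (R := k) (C := H))) x).symm

variable {Sinv : H →ₗ[k] H}

lemma mul_of_antipode_inverse (h₁ : ∀ x : H, Sinv (antipode k x) = x)
    (h₂ : ∀ x : H, antipode k (Sinv x) = x) (x y : H) : Sinv (x * y) = Sinv y * Sinv x := by
  rw [← h₁ (Sinv y * Sinv x), antipode_mul_antidistrib, h₂, h₂]

lemma one_of_antipode_inverse (h₁ : ∀ x : H, Sinv (antipode k x) = x) : Sinv 1 = 1 := by
  simpa using h₁ 1

lemma comul_of_antipode_inverse (h₁ : ∀ x : H, Sinv (antipode k x) = x)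
    (h₂ : ∀ x : H, antipode k (Sinv x) = x) (x : H) :
    comul (R := k) (Sinv x) =
      TensorProduct.map Sinv Sinv (TensorProduct.comm k H H (comul x)) := by
  have h : Sinv ∘ₗ antipode k = LinearMap.id := LinearMap.ext h₁
  have hx := comul_antipode (k := k) (Sinv x)
  rw [h₂] at hx
  rw [hx, ← TensorProduct.map_comm, TensorProduct.map_map, h]
  simp

lemma sum_antipode_inverse_mul (h₁ : ∀ x : H, Sinv (antipode k x) = x)
    (h₂ : ∀ x : H, antipode k (Sinv x) = x) (x : H) :
    ∑ i ∈ (ℛ k x).index, Sinv ((ℛ k x).right i) * (ℛ k x).left i = counit (R := k) x • 1 := by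
  have h := congr(Sinv $(sum_antipode_mul_eq_smul (ℛ k x)))
  simpa [mul_of_antipode_inverse h₁ h₂, h₁, one_of_antipode_inverse h₁] using h

end HopfAlgebra

section Mirror

open Coalgebra HopfAlgebra

variable {k} {H : Type*} [Semiring H] [HopfAlgebra k H] {Sinv : H →ₗ[k] H}

lemma adAction_antipode_inverse (h₁ : ∀ x : H, Sinv (antipode k x) = x)
    (h₂ : ∀ x : H, antipode k (Sinv x) = x) (b x : H) :
    adAction k H (b ⊗ₜ Sinv x) =
      ∑ i ∈ (ℛ k x).index, (ℛ k x).right i * (b * Sinv ((ℛ k x).left i)) := by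
  simp [adAction, comul_of_antipode_inverse h₁ h₂, ← (ℛ k x).eq, TensorProduct.sum_tmul, h₂]

lemma sum_adAction_antipode_inverse_mul (h₁ : ∀ x : H, Sinv (antipode k x) = x)
    (h₂ : ∀ x : H, antipode k (Sinv x) = x) (b x : H) :
    ∑ i ∈ (ℛ k x).index, adAction k H (b ⊗ₜ Sinv ((ℛ k x).right i)) * (ℛ k x).left i = x * b := by
  let F : H ⊗[k] (H ⊗[k] H) →ₗ[k] H :=
    LinearMap.mul' k H ∘ₗ (TensorProduct.comm k H H).toLinearMap ∘ₗ
      TensorProduct.map (LinearMap.mulLeft k b ∘ₗ LinearMap.mul' k H ∘ₗ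
        Sinv.rTensor H ∘ₗ (TensorProduct.comm k H H).toLinearMap) LinearMap.id ∘ₗ
      (TensorProduct.assoc k H H H).symm.toLinearMap
  have hF (a c d : H) : F (a ⊗ₜ (c ⊗ₜ d)) = d * (b * (Sinv c * a)) := by simp [F]
  have h := congr(F $(sum_tmul_tmul_eq (ℛ k x)
      (fun i ↦ ℛ k ((ℛ k x).left i)) (fun i ↦ ℛ k ((ℛ k x).right i))))
  simp only [map_sum, hF, ← Finset.mul_sum, sum_antipode_inverse_mul h₁ h₂, mul_smul_comm,
    mul_one, ← smul_mul_assoc, ← Finset.sum_mul, sum_counit_smul] at h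
  rw [h]
  simp only [adAction_antipode_inverse h₁ h₂, Finset.sum_mul, mul_assoc]

lemma mirrorTarget_apply (g : H) :
    mirrorTarget k H Sinv g =
      ∑ i ∈ (ℛ k g).index, Sinv ((ℛ k g).right i) ⊗ₜ[k] (ℛ k g).left i := by
  simp [mirrorTarget, ← (ℛ k g).eq]

/-- Right multiplication by the target: `(a ⊗ b) t(g) = a S⁻¹(g₂) ⊗ g₁ b`. -/
lemma mirrorMul_mirrorTarget (h₁ : ∀ x : H, Sinv (antipode k x) = x)
    (h₂ : ∀ x : H, antipode k (Sinv x) = x) (a b g : H) :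
    mirrorMul k H ((a ⊗ₜ b) ⊗ₜ mirrorTarget k H Sinv g) =
      ∑ i ∈ (ℛ k g).index, (a * Sinv ((ℛ k g).right i)) ⊗ₜ[k] ((ℛ k g).left i * b) := by
  let G : H ⊗[k] H →ₗ[k] H := LinearMap.mul' k H ∘ₗ
    TensorProduct.map (adAction k H ∘ₗ TensorProduct.mk k H H b ∘ₗ Sinv) LinearMap.id ∘ₗ
      (TensorProduct.comm k H H).toLinearMap
  let F : H ⊗[k] (H ⊗[k] H) →ₗ[k] H ⊗[k] H :=
    TensorProduct.map (LinearMap.mulLeft k a ∘ₗ Sinv) G ∘ₗ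
      (TensorProduct.comm k (H ⊗[k] H) H).toLinearMap ∘ₗ
      (TensorProduct.assoc k H H H).symm.toLinearMap
  have hF (c d e : H) : F (c ⊗ₜ (d ⊗ₜ e)) =
      (a * Sinv e) ⊗ₜ[k] (adAction k H (b ⊗ₜ Sinv d) * c) := by simp [F, G]
  have h := congr(F $(sum_tmul_tmul_eq (ℛ k g)
      (fun i ↦ ℛ k ((ℛ k g).left i)) (fun i ↦ ℛ k ((ℛ k g).right i))))
  simp only [map_sum, hF] at h
  simp only [← TensorProduct.tmul_sum, sum_adAction_antipode_inverse_mul h₁ h₂] at h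
  rw [h, mirrorTarget_apply, TensorProduct.tmul_sum, map_sum]
  refine Finset.sum_congr rfl fun i _ ↦ ?_
  simp [mirrorMul, comul_of_antipode_inverse h₁ h₂, ← (ℛ k ((ℛ k g).right i)).eq,
    TensorProduct.sum_tmul, TensorProduct.tmul_sum]

end Mirror

theorem mirror_source_target
    {H : Type*} [Semiring H] [HopfAlgebra k H]
    -- S is bijective, with linear inverse Sinv = S⁻¹
    (Sinv : H →ₗ[k] H)
    (hSinv₁ : ∀ x : H, Sinv (HopfAlgebra.antipode (R := k) x) = x)
    (hSinv₂ : ∀ x : H, HopfAlgebra.antipode (R := k) (Sinv x) = x) :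
    -- t reverses the product: t(g) t(g') = t(g' g)
    (∀ g g' : H, mirrorMul k H (mirrorTarget k H Sinv g ⊗ₜ mirrorTarget k H Sinv g') =
      mirrorTarget k H Sinv (g' * g)) ∧
    -- the ranges of s and t commute: s(g') t(g) = t(g) s(g')
    (∀ g g' : H, mirrorMul k H (((1 : H) ⊗ₜ g') ⊗ₜ mirrorTarget k H Sinv g) =
      mirrorMul k H (mirrorTarget k H Sinv g ⊗ₜ ((1 : H) ⊗ₜ g'))) := by
  refine ⟨fun g g' ↦ ?_, fun g g' ↦ ?_⟩
  · rw [mirrorTarget_apply g, TensorProduct.sum_tmul, map_sum]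
    simp only [mirrorMul_mirrorTarget hSinv₁ hSinv₂]
    simp [mirrorTarget, ← (Coalgebra.Repr.arbitrary k g).eq,
      ← (Coalgebra.Repr.arbitrary k g').eq, Finset.sum_mul_sum,
      HopfAlgebra.mul_of_antipode_inverse hSinv₁ hSinv₂]
    exact Finset.sum_comm
  · rw [mirrorMul_mirrorTarget hSinv₁ hSinv₂, mirrorTarget_apply, TensorProduct.sum_tmul, map_sum]
    refine Finset.sum_congr rfl fun i _ ↦ ?_
    simp [mirrorMul, adAction, Algebra.TensorProduct.one_def]
end

section
/- Let H be a Hopf algebra over a field k whose antipode satisfies S² = id, and equip H ⊗ H with the mirror bicrossproduct product (a ⊗ b)(a' ⊗ b') = a a'₁ ⊗ S(a'₂) b a'₃ b'. Then the linear map T : H ⊗ H → H ⊗ H defined by T(a ⊗ g) := S(g₂) S(a₃) ⊗ a₂ g₁ S(a₁) is an anti-algebra map: T(X Y) = T(Y) T(X) for all X, Y ∈ H ⊗ H, and T(1 ⊗ g) = S(g₂) ⊗ g₁. -/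
/-!
STATEMENT 14: For a Hopf algebra H with S² = id, on the mirror bicrossproduct H ⊗ H with product
(a ⊗ b)(a' ⊗ b') = a a'₁ ⊗ S(a'₂) b a'₃ b', the Hopf-algebroid antipode
T(a ⊗ g) := S(g₂) S(a₃) ⊗ a₂ g₁ S(a₁) is an anti-algebra map: T(XY) = T(Y)T(X), and
T(1 ⊗ g) = S(g₂) ⊗ g₁. -/

open TensorProduct

variable (k : Type*) [Field k]

/-- The Hopf-algebroid antipode of the mirror bicrossproduct:
`T(a ⊗ g) = S(g₂) S(a₃) ⊗ a₂ g₁ S(a₁)`. -/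
noncomputable def mirrorAntipode (H : Type*) [Semiring H] [HopfAlgebra k H] :
    H ⊗[k] H →ₗ[k] H ⊗[k] H :=
  (TensorProduct.comm k H H).toLinearMap
    ∘ₗ TensorProduct.map
        -- `(a₁ ⊗ a₂) ⊗ g₁ ↦ a₂ g₁ S(a₁)`
        (LinearMap.mul' k H
          ∘ₗ TensorProduct.map LinearMap.id (LinearMap.mul' k H)
          ∘ₗ (TensorProduct.assoc k H H H).toLinearMap
          ∘ₗ TensorProduct.map LinearMap.id (HopfAlgebra.antipode (R := k))
          ∘ₗ (TensorProduct.comm k H (H ⊗[k] H)).toLinearMap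
          ∘ₗ (TensorProduct.assoc k H H H).toLinearMap)
        -- `a₃ ⊗ g₂ ↦ S(g₂) S(a₃)`
        (LinearMap.mul' k H
          ∘ₗ TensorProduct.map (HopfAlgebra.antipode (R := k)) (HopfAlgebra.antipode (R := k))
          ∘ₗ (TensorProduct.comm k H H).toLinearMap)
    ∘ₗ (TensorProduct.tensorTensorTensorComm k (H ⊗[k] H) H H H).toLinearMap
    ∘ₗ TensorProduct.map
        ((TensorProduct.map (Coalgebra.comul (R := k)) LinearMap.id)
          ∘ₗ Coalgebra.comul (R := k))
        (Coalgebra.comul (R := k))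

open Coalgebra HopfAlgebra LinearMap

section MirrorBicrossproduct

variable {k} {H : Type*} [Semiring H] [HopfAlgebra k H]

lemma adAction_tmul {b c : H} (r : Repr k c (H × H)) :
    adAction k H (b ⊗ₜ c) = ∑ i ∈ r.index, antipode k (r.left i) * (b * r.right i) := by
  simp [adAction, ← r.eq, TensorProduct.sum_tmul]

lemma mirrorMul_tmul (a b d : H) {c : H} (r : Repr k c (H × H)) :
    mirrorMul k H ((a ⊗ₜ b) ⊗ₜ (c ⊗ₜ d)) =
      ∑ i ∈ r.index, (a * r.left i) ⊗ₜ (adAction k H (b ⊗ₜ r.right i) * d) := by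
  simp [mirrorMul, ← r.eq, TensorProduct.sum_tmul, TensorProduct.tmul_sum]

/-- Coassociativity, seen through a linear map. -/
lemma map_sum_coassoc {M : Type*} [AddCommMonoid M] [Module k M] (f : H ⊗[k] (H ⊗[k] H) →ₗ[k] M)
    (h : H) :
    ∑ i ∈ (ℛ k h).index, ∑ j ∈ (ℛ k ((ℛ k h).left i)).index,
        f ((ℛ k ((ℛ k h).left i)).left j ⊗ₜ
          ((ℛ k ((ℛ k h).left i)).right j ⊗ₜ (ℛ k h).right i)) =
      ∑ i ∈ (ℛ k h).index, ∑ j ∈ (ℛ k ((ℛ k h).right i)).index,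
        f ((ℛ k h).left i ⊗ₜ
          ((ℛ k ((ℛ k h).right i)).left j ⊗ₜ (ℛ k ((ℛ k h).right i)).right j)) := by
  simpa only [map_sum] using congr(f $(sum_tmul_tmul_eq (ℛ k h) (fun _ => ℛ k _) fun _ => ℛ k _))

lemma sum_counit_right_smul_left (h : H) :
    ∑ i ∈ (ℛ k h).index, counit (R := k) ((ℛ k h).right i) • (ℛ k h).left i = h := by
  simpa only [map_sum, TensorProduct.rid_tmul, one_smul] using
    congr(TensorProduct.rid k H $(sum_tmul_counit_eq (ℛ k h)))

/-- `c₁ S(c₂) b c₃ = b c`. -/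
lemma sum_mul_adAction (b c : H) :
    ∑ i ∈ (ℛ k c).index, (ℛ k c).left i * adAction k H (b ⊗ₜ (ℛ k c).right i) = b * c := by
  have key := map_sum_coassoc
    (mul' k H ∘ₗ TensorProduct.map .id
      (mul' k H ∘ₗ TensorProduct.map (antipode k) (mulLeft k b))) c
  simp only [comp_apply, TensorProduct.map_tmul, mul'_apply, id_apply, mulLeft_apply,
    ← Finset.mul_sum, ← adAction_tmul] at key
  rw [← key]
  simp only [← mul_assoc, ← Finset.sum_mul, sum_mul_antipode_eq_smul]
  simp only [smul_mul_assoc, one_mul]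
  simp only [← mul_smul_comm, ← Finset.mul_sum, sum_counit_smul]

variable (k H) in
/-- The map `a ⊗ b ↦ a₁ ⊗ a₂ b`, which carries the mirror bicrossproduct multiplication to the
componentwise one. -/
noncomputable def mirrorUntwist : H ⊗[k] H →ₗ[k] H ⊗[k] H :=
  mul' k (H ⊗[k] H) ∘ₗ TensorProduct.map comul (TensorProduct.mk k H H 1)

@[simp]
lemma mirrorUntwist_tmul (a b : H) :
    mirrorUntwist k H (a ⊗ₜ b) = comul (R := k) a * (1 ⊗ₜ b) := rfl

lemma mirrorUntwist_mul (X : H ⊗[k] H) (b : H) :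
    mirrorUntwist k H (X * (1 ⊗ₜ b)) = mirrorUntwist k H X * (1 ⊗ₜ b) := by
  induction X with
  | zero => simp
  | add x y hx hy => simp only [add_mul, map_add, hx, hy]
  | tmul x y => simp [mul_assoc]

lemma sum_comul_mul_adAction (b c : H) :
    ∑ i ∈ (ℛ k c).index, comul (R := k) ((ℛ k c).left i) *
        ((1 : H) ⊗ₜ adAction k H (b ⊗ₜ (ℛ k c).right i)) = (1 ⊗ₜ b) * comul (R := k) c := by
  have key := map_sum_coassoc
    (TensorProduct.map .id (mul' k H ∘ₗ TensorProduct.map .id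
      (adAction k H ∘ₗ TensorProduct.mk k H H b))) c
  simp only [comp_apply, TensorProduct.map_tmul, mul'_apply, id_apply, TensorProduct.mk_apply,
    ← TensorProduct.tmul_sum, sum_mul_adAction] at key
  rw [← (ℛ k c).eq]
  simp only [Finset.mul_sum, Algebra.TensorProduct.tmul_mul_tmul, one_mul, ← key]
  refine Finset.sum_congr rfl fun i _ => ?_
  rw [← (ℛ k ((ℛ k c).left i)).eq]
  simp only [Finset.sum_mul, Algebra.TensorProduct.tmul_mul_tmul, mul_one]

lemma mirrorUntwist_mirrorMul (X Y : H ⊗[k] H) :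
    mirrorUntwist k H (mirrorMul k H (X ⊗ₜ Y)) =
      mirrorUntwist k H X * mirrorUntwist k H Y := by
  induction X with
  | zero => simp
  | add x y hx hy => simp only [TensorProduct.add_tmul, map_add, hx, hy, add_mul]
  | tmul a b =>
    induction Y with
    | zero => simp
    | add x y hx hy => simp only [TensorProduct.tmul_add, map_add, hx, hy, mul_add]
    | tmul c d =>
      rw [mirrorMul_tmul a b d (ℛ k c)]
      have hsplit (x : H) : (1 : H) ⊗ₜ[k] (x * d) = (1 ⊗ₜ x) * (1 ⊗ₜ d) := by simp
      simp only [map_sum, mirrorUntwist_tmul, Bialgebra.comul_mul, hsplit, mul_assoc]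
      rw [← mul_assoc (1 ⊗ₜ b), ← sum_comul_mul_adAction]
      simp only [← Finset.mul_sum, Finset.sum_mul, mul_assoc]

lemma mirrorUntwist_injective : Function.Injective (mirrorUntwist k H) := by
  refine Function.LeftInverse.injective (g := TensorProduct.map .id (mul' k H) ∘ₗ
    TensorProduct.assoc k H H H ∘ₗ
      TensorProduct.map (TensorProduct.map .id (antipode k) ∘ₗ comul) .id) fun X => ?_
  induction X with
  | zero => simp
  | add x y hx hy => simp only [map_add, hx, hy]
  | tmul a b =>
    have key := map_sum_coassoc
      (TensorProduct.map .id (mulRight k b ∘ₗ mul' k H ∘ₗ TensorProduct.map (antipode k) .id)) a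
    simp only [comp_apply, TensorProduct.map_tmul, mul'_apply, id_apply, mulRight_apply,
      ← TensorProduct.tmul_sum, ← Finset.sum_mul, sum_antipode_mul_eq_smul] at key
    simp only [smul_mul_assoc, one_mul, ← TensorProduct.smul_tmul, ← TensorProduct.sum_tmul] at key
    rw [mirrorUntwist_tmul, ← (ℛ k a).eq]
    simp only [Finset.sum_mul, Algebra.TensorProduct.tmul_mul_tmul, mul_one, map_sum, comp_apply,
      TensorProduct.map_tmul, id_apply]
    have hexp (x y : H) : TensorProduct.map .id (mul' k H) (TensorProduct.assoc k H H H
        (TensorProduct.map .id (antipode k) (comul (R := k) x) ⊗ₜ y)) =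
        ∑ j ∈ (ℛ k x).index, (ℛ k x).left j ⊗ₜ (antipode k ((ℛ k x).right j) * y) := by
      conv_lhs => rw [← (ℛ k x).eq]
      simp [TensorProduct.sum_tmul]
    simp only [LinearEquiv.coe_coe, hexp, ← mul_assoc, key]
    congr 1
    exact sum_counit_right_smul_left a

lemma sum_antipode_right_mul_left
    (hS2 : ∀ x : H, antipode k (antipode k x) = x) (h : H) :
    ∑ i ∈ (ℛ k h).index, antipode k ((ℛ k h).right i) * (ℛ k h).left i =
      counit (R := k) h • 1 := by
  have := congr(antipode k $(sum_antipode_mul_eq_smul (ℛ k h)))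
  simpa [antipode_mul_antidistrib, hS2] using this

lemma sum_right_mul_antipode_left
    (hS2 : ∀ x : H, antipode k (antipode k x) = x) (h : H) :
    ∑ i ∈ (ℛ k h).index, (ℛ k h).right i * antipode k ((ℛ k h).left i) =
      counit (R := k) h • 1 := by
  have := congr(antipode k $(sum_mul_antipode_eq_smul (ℛ k h)))
  simpa [antipode_mul_antidistrib, hS2] using this

lemma sum_comul_mul_antipode_tmul_one
    (hS2 : ∀ x : H, antipode k (antipode k x) = x) (h : H) :
    ∑ i ∈ (ℛ k h).index, comul (R := k) ((ℛ k h).right i) *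
        (antipode k ((ℛ k h).left i) ⊗ₜ (1 : H)) = 1 ⊗ₜ h := by
  have key := map_sum_coassoc
    (TensorProduct.map (mul' k H ∘ₗ (TensorProduct.comm k H H).toLinearMap ∘ₗ
      TensorProduct.map (antipode k) .id) .id ∘ₗ (TensorProduct.assoc k H H H).symm.toLinearMap) h
  simp only [comp_apply, LinearEquiv.coe_coe, TensorProduct.assoc_symm_tmul,
    TensorProduct.map_tmul, TensorProduct.comm_tmul, mul'_apply, id_apply,
    ← TensorProduct.sum_tmul, sum_right_mul_antipode_left hS2] at key
  simp only [TensorProduct.smul_tmul, ← TensorProduct.tmul_sum, sum_counit_smul] at key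
  rw [key]
  refine Finset.sum_congr rfl fun i _ => ?_
  rw [← (ℛ k ((ℛ k h).right i)).eq]
  simp only [Finset.sum_mul, Algebra.TensorProduct.tmul_mul_tmul, mul_one]

lemma mirrorUntwist_map_antipode_comm_comul
    (hS2 : ∀ x : H, antipode k (antipode k x) = x) (h : H) :
    mirrorUntwist k H (TensorProduct.map (antipode k) .id
      (TensorProduct.comm k H H (comul (R := k) h))) = antipode k h ⊗ₜ 1 := by
  have key := map_sum_coassoc
    (mul' k (H ⊗[k] H) ∘ₗ (TensorProduct.comm k _ _).toLinearMap ∘ₗ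
      TensorProduct.map ((TensorProduct.mk k H H).flip 1 ∘ₗ antipode k)
        (comul ∘ₗ mul' k H ∘ₗ (TensorProduct.comm k H H).toLinearMap ∘ₗ
          TensorProduct.map .id (antipode k))) h
  simp only [comp_apply, LinearEquiv.coe_coe, TensorProduct.map_tmul, TensorProduct.comm_tmul,
    mul'_apply, id_apply, flip_apply, TensorProduct.mk_apply, ← map_sum, ← Finset.sum_mul,
    sum_antipode_right_mul_left hS2] at key
  simp only [Bialgebra.comul_mul, mul_assoc, ← Finset.mul_sum,
    sum_comul_mul_antipode_tmul_one hS2] at key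
  conv_lhs => rw [← (ℛ k h).eq]
  simp only [map_sum, TensorProduct.comm_tmul, TensorProduct.map_tmul, id_apply,
    mirrorUntwist_tmul, key, map_smul, Bialgebra.comul_one, smul_mul_assoc, one_mul]
  simp only [TensorProduct.smul_tmul', ← map_smul, ← TensorProduct.sum_tmul, ← map_sum]
  congr 2
  exact sum_counit_right_smul_left h

lemma mirrorAntipode_tmul (a g : H) :
    mirrorAntipode k H (a ⊗ₜ g) = ∑ i ∈ (ℛ k a).index,
      TensorProduct.map (antipode k) .id
        (TensorProduct.comm k H H (comul (R := k) ((ℛ k a).right i * g))) *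
      (1 ⊗ₜ antipode k ((ℛ k a).left i)) := by
  have key := map_sum_coassoc
    (∑ l ∈ (ℛ k g).index,
      TensorProduct.map (mulLeft k (antipode k ((ℛ k g).right l)) ∘ₗ antipode k)
        (mul' k H ∘ₗ (TensorProduct.comm k H H).toLinearMap ∘ₗ
          TensorProduct.map (mulLeft k ((ℛ k g).left l) ∘ₗ antipode k) .id) ∘ₗ
      (TensorProduct.comm k (H ⊗[k] H) H).toLinearMap ∘ₗ
      (TensorProduct.assoc k H H H).symm.toLinearMap) a
  simp only [LinearMap.sum_apply, comp_apply, LinearEquiv.coe_coe, TensorProduct.assoc_symm_tmul,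
    TensorProduct.map_tmul, TensorProduct.comm_tmul, mul'_apply, id_apply, mulLeft_apply] at key
  have hcomul : TensorProduct.map comul .id (comul (R := k) a) =
      ∑ i ∈ (ℛ k a).index, ∑ j ∈ (ℛ k ((ℛ k a).left i)).index,
        ((ℛ k ((ℛ k a).left i)).left j ⊗ₜ[k] (ℛ k ((ℛ k a).left i)).right j) ⊗ₜ[k]
          (ℛ k a).right i := by
    simp only [← TensorProduct.sum_tmul, Repr.eq]
    conv_lhs => rw [← (ℛ k a).eq]
    simp only [map_sum, TensorProduct.map_tmul, id_apply]
  refine Eq.trans ?_ (key.trans ?_)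
  · unfold mirrorAntipode
    simp only [comp_apply, TensorProduct.map_tmul, hcomul]
    rw [← (ℛ k g).eq]
    simp only [TensorProduct.sum_tmul, TensorProduct.tmul_sum, map_sum, comp_apply,
      LinearEquiv.coe_coe, TensorProduct.tensorTensorTensorComm_tmul, TensorProduct.map_tmul,
      TensorProduct.assoc_tmul, TensorProduct.comm_tmul, mul'_apply, id_apply]
    rw [Finset.sum_comm]
    exact Finset.sum_congr rfl fun i _ => Finset.sum_comm
  · refine Finset.sum_congr rfl fun i _ => ?_
    rw [Finset.sum_comm, Bialgebra.comul_mul, ← (ℛ k ((ℛ k a).right i)).eq, ← (ℛ k g).eq]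
    simp [Finset.sum_mul, Finset.mul_sum, antipode_mul_antidistrib, mul_assoc]

lemma mirrorUntwist_mirrorAntipode
    (hS2 : ∀ x : H, antipode k (antipode k x) = x) (X : H ⊗[k] H) :
    mirrorUntwist k H (mirrorAntipode k H X) =
      TensorProduct.map (antipode k) (antipode k)
        (TensorProduct.comm k H H (mirrorUntwist k H X)) := by
  induction X with
  | zero => simp
  | add x y hx hy => simp only [map_add, hx, hy]
  | tmul a g =>
    simp only [mirrorAntipode_tmul, map_sum, mirrorUntwist_mul,
      mirrorUntwist_map_antipode_comm_comul hS2, mirrorUntwist_tmul]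
    rw [← (ℛ k a).eq]
    simp [Finset.sum_mul]

lemma map_antipode_comm_mul (X Y : H ⊗[k] H) :
    TensorProduct.map (antipode k) (antipode k) (TensorProduct.comm k H H (X * Y)) =
      TensorProduct.map (antipode k) (antipode k) (TensorProduct.comm k H H Y) *
        TensorProduct.map (antipode k) (antipode k) (TensorProduct.comm k H H X) := by
  induction X with
  | zero => simp
  | add x y hx hy => simp only [add_mul, mul_add, map_add, hx, hy]
  | tmul a b =>
    induction Y with
    | zero => simp
    | add x y hx hy => simp only [add_mul, mul_add, map_add, hx, hy]
    | tmul c d => simp [antipode_mul_antidistrib]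

end MirrorBicrossproduct

theorem mirrorAntipode_antimul
    {H : Type*} [Semiring H] [HopfAlgebra k H]
    -- the antipode of H squares to the identity
    (hS2 : ∀ x : H, HopfAlgebra.antipode (R := k) (HopfAlgebra.antipode (R := k) x) = x) :
    (∀ X Y : H ⊗[k] H, mirrorAntipode k H (mirrorMul k H (X ⊗ₜ Y)) =
      mirrorMul k H (mirrorAntipode k H Y ⊗ₜ mirrorAntipode k H X)) ∧
    (∀ g : H, mirrorAntipode k H ((1 : H) ⊗ₜ g) =
      TensorProduct.map (HopfAlgebra.antipode (R := k)) LinearMap.id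
        ((TensorProduct.comm k H H) (Coalgebra.comul (R := k) g))) := by
  refine ⟨fun X Y => mirrorUntwist_injective ?_, fun g => ?_⟩
  · simp only [mirrorUntwist_mirrorAntipode hS2, mirrorUntwist_mirrorMul, map_antipode_comm_mul]
  · apply mirrorUntwist_injective
    rw [mirrorUntwist_mirrorAntipode hS2, mirrorUntwist_map_antipode_comm_comul hS2]
    simp [Algebra.TensorProduct.one_def]
end

section
/- Let H be a Hopf algebra over a field k whose antipode satisfies S² = id. Then the linear map T : H ⊗ H → H ⊗ H defined by T(a ⊗ g) := S(g₂) S(a₃) ⊗ a₂ g₁ S(a₁) is an involution: T(T(a ⊗ g)) = a ⊗ g for all a, g ∈ H. -/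
/-!
STATEMENT 15: For a Hopf algebra H with S² = id, the Hopf-algebroid antipode of the mirror
bicrossproduct, T(a ⊗ g) := S(g₂) S(a₃) ⊗ a₂ g₁ S(a₁), is an involution:
T(T(a ⊗ g)) = a ⊗ g. -/

open TensorProduct

variable (k : Type*) [Field k]

namespace HopfAlgebra

open Coalgebra WithConv Algebra.TensorProduct

variable (H : Type*) [Semiring H] [HopfAlgebra k H]

/-- The map `a ↦ a ⊗ 1`. -/
noncomputable def convInl : WithConv (H →ₗ[k] H ⊗[k] H) :=
  toConv (includeLeft : H →ₐ[k] H ⊗[k] H).toLinearMap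

/-- The map `a ↦ 1 ⊗ a`. -/
noncomputable def convInr : WithConv (H →ₗ[k] H ⊗[k] H) :=
  toConv (includeRight : H →ₐ[k] H ⊗[k] H).toLinearMap

/-- The map `a ↦ S(a) ⊗ 1`. -/
noncomputable def convInlAntipode : WithConv (H →ₗ[k] H ⊗[k] H) :=
  toConv ((includeLeft : H →ₐ[k] H ⊗[k] H).toLinearMap ∘ₗ antipode k)

/-- The map `a ↦ 1 ⊗ S(a)`. -/
noncomputable def convInrAntipode : WithConv (H →ₗ[k] H ⊗[k] H) :=
  toConv ((includeRight : H →ₐ[k] H ⊗[k] H).toLinearMap ∘ₗ antipode k)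

variable {k H}

@[simp] lemma convInl_apply (a : H) : convInl k H a = a ⊗ₜ 1 := rfl

@[simp] lemma convInr_apply (a : H) : convInr k H a = 1 ⊗ₜ a := rfl

@[simp] lemma convInlAntipode_apply (a : H) :
    convInlAntipode k H a = antipode k a ⊗ₜ 1 := rfl

@[simp] lemma convInrAntipode_apply (a : H) :
    convInrAntipode k H a = 1 ⊗ₜ antipode k a := rfl

lemma convInlAntipode_mul_convInl : convInlAntipode k H * convInl k H = 1 := by
  ext a
  rw [(ℛ k a).convMul_apply]
  simp [← TensorProduct.sum_tmul, sum_antipode_mul_eq_algebraMap_counit,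
    Algebra.TensorProduct.algebraMap_apply]

lemma convInrAntipode_mul_convInr : convInrAntipode k H * convInr k H = 1 := by
  ext a
  rw [(ℛ k a).convMul_apply]
  simp [← TensorProduct.tmul_sum, sum_antipode_mul_eq_algebraMap_counit,
    Algebra.algebraMap_eq_smul_one, one_def]

lemma convInl_mul_convInr : convInl k H * convInr k H = toConv comul := by
  ext a
  rw [(ℛ k a).convMul_apply]
  simp [(ℛ k a).eq]

lemma comul_antipode_eq_convMul :
    toConv (comul ∘ₗ antipode k) = convInrAntipode k H * convInlAntipode k H := by
  refine (left_inv_eq_right_inv ?_ LinearMap.comul_right_inv).symm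
  rw [← convInl_mul_convInr, mul_assoc, ← mul_assoc (convInlAntipode k H),
    convInlAntipode_mul_convInl, one_mul, convInrAntipode_mul_convInr]

lemma comul_antipode_s15 (a : H) :
    comul (antipode k a) =
      ∑ i ∈ (ℛ k a).index, antipode k ((ℛ k a).right i) ⊗ₜ[k] antipode k ((ℛ k a).left i) := by
  have h := congr($(comul_antipode_eq_convMul (k := k) (H := H)) a)
  rw [(ℛ k a).convMul_apply] at h
  simpa using h

/-- The map `a ⊗ g ↦ f(a) (1 ⊗ g)`. -/
noncomputable def mulRightSnd (f : WithConv (H →ₗ[k] H ⊗[k] H)) : H ⊗[k] H →ₗ[k] H ⊗[k] H :=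
  LinearMap.mul' k (H ⊗[k] H) ∘ₗ TensorProduct.map f.ofConv (convInr k H).ofConv

/-- The map `a ⊗ p ↦ (1 ⊗ a) f(p)`. -/
noncomputable def mulLeftSnd (f : WithConv (H →ₗ[k] H ⊗[k] H)) : H ⊗[k] H →ₗ[k] H ⊗[k] H :=
  LinearMap.mul' k (H ⊗[k] H) ∘ₗ TensorProduct.map (convInr k H).ofConv f.ofConv

@[simp] lemma mulRightSnd_tmul (f : WithConv (H →ₗ[k] H ⊗[k] H)) (a g : H) :
    mulRightSnd f (a ⊗ₜ g) = f a * (1 ⊗ₜ g) := rfl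

@[simp] lemma mulLeftSnd_tmul (f : WithConv (H →ₗ[k] H ⊗[k] H)) (a p : H) :
    mulLeftSnd f (a ⊗ₜ p) = (1 ⊗ₜ a) * f p := rfl

lemma mulRightSnd_mulRightSnd_comul (f : WithConv (H →ₗ[k] H ⊗[k] H)) (a g : H) :
    mulRightSnd f (mulRightSnd (toConv comul) (a ⊗ₜ g)) =
      mulRightSnd (f * convInr k H) (a ⊗ₜ g) := by
  simp only [mulRightSnd_tmul, (ℛ k a).convMul_apply]
  simp [← (ℛ k a).eq, Finset.sum_mul, mul_assoc]

lemma mulRightSnd_comul_injective :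
    Function.Injective (mulRightSnd (toConv (comul (R := k) (A := H)))) := by
  refine Function.LeftInverse.injective
    (g := mulRightSnd (convInl k H * convInrAntipode k H)) fun t ↦ ?_
  induction t with
  | zero => simp
  | add x y hx hy => simp [hx, hy]
  | tmul a g =>
    rw [mulRightSnd_mulRightSnd_comul, mul_assoc, convInrAntipode_mul_convInr, mul_one]
    simp

/-- The factor `a ⊗ p ↦ S(p₂) ⊗ p₁ S(a)` of the mirror antipode. -/
noncomputable def mirrorAntipodeFactor : H ⊗[k] H →ₗ[k] H ⊗[k] H :=
  TensorProduct.lift <| LinearMap.mk₂ k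
    (fun a p ↦ TensorProduct.comm k H H
      (TensorProduct.map (LinearMap.mulRight k (antipode k a)) (antipode k) (comul p)))
    (fun a b p ↦ by
      rw [map_add, show LinearMap.mulRight k (antipode k a + antipode k b) = LinearMap.mulRight k
        (antipode k a) + LinearMap.mulRight k (antipode k b) by ext; simp [mul_add]]
      simp [TensorProduct.map_add_left])
    (fun c a p ↦ by
      rw [map_smul, show LinearMap.mulRight k (c • antipode k a) = c • LinearMap.mulRight k
        (antipode k a) by ext; simp]
      simp [TensorProduct.map_smul_left])
    (fun a p q ↦ by simp)
    (fun c a p ↦ by simp)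

lemma mirrorAntipodeFactor_tmul (a p : H) :
    mirrorAntipodeFactor (a ⊗ₜ[k] p) = TensorProduct.comm k H H
      (TensorProduct.map (LinearMap.mulRight k (antipode k a)) (antipode k) (comul p)) := rfl

lemma mirrorAntipode_tmul (a g : H) :
    mirrorAntipode k H (a ⊗ₜ g) =
      mirrorAntipodeFactor (mulRightSnd (toConv comul) (a ⊗ₜ g)) := by
  have h : TensorProduct.map comul LinearMap.id (comul (R := k) a) =
      (TensorProduct.assoc k H H H).symm (comul.lTensor H (comul a)) :=
    (coassoc_symm_apply a).symm
  rw [mulRightSnd_tmul]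
  change _ = mirrorAntipodeFactor (comul a * 1 ⊗ₜ g)
  simp only [mirrorAntipode, LinearMap.comp_apply, TensorProduct.map_tmul, h]
  generalize comul (R := k) a = w
  induction w with
  | zero => simp
  | add x y hx hy => simp only [map_add, TensorProduct.add_tmul, add_mul, hx, hy]
  | tmul x y =>
    simp only [LinearMap.lTensor_tmul, tmul_mul_tmul, mul_one, mirrorAntipodeFactor_tmul,
      Bialgebra.comul_mul]
    generalize comul (R := k) y = u
    generalize comul (R := k) g = v
    induction u with
    | zero => simp
    | add u u' hu hu' =>
      simp only [map_add, TensorProduct.tmul_add, TensorProduct.add_tmul, add_mul, hu, hu']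
    | tmul y z =>
      induction v with
      | zero => simp
      | add v v' hv hv' => simp only [map_add, TensorProduct.tmul_add, mul_add, hv, hv']
      | tmul g g' => simp [antipode_mul_antidistrib, mul_assoc]

/-- If `S² = id`, then `φ ∘ θ` is the flip composed with `S ⊗ S`, where `φ(a ⊗ g) = a₁ ⊗ a₂ g` and
`θ(a ⊗ p) = S(p₂) ⊗ p₁ S(a)`. -/
lemma mulRightSnd_comul_mirrorAntipodeFactor
    (hS2 : ∀ x : H, antipode k (antipode k x) = x) (a p : H) :
    mulRightSnd (toConv comul) (mirrorAntipodeFactor (a ⊗ₜ[k] p)) =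
      antipode k p ⊗ₜ antipode k a := by
  have hθ : mirrorAntipodeFactor (a ⊗ₜ[k] p) = TensorProduct.map (antipode k) (antipode k)
      (∑ i ∈ (ℛ k p).index, (ℛ k p).right i ⊗ₜ[k] (a * antipode k ((ℛ k p).left i))) := by
    rw [mirrorAntipodeFactor_tmul, ← (ℛ k p).eq]
    simp [antipode_mul_antidistrib, hS2]
  have hφ (x y : H) : mulRightSnd (toConv comul) (antipode k x ⊗ₜ[k] antipode k y) =
      TensorProduct.map (antipode k) (antipode k)
        (mulLeftSnd (convInr k H * convInl k H) (y ⊗ₜ x)) := by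
    simp only [mulRightSnd_tmul, mulLeftSnd_tmul, (ℛ k x).convMul_apply]
    simp [comul_antipode_s15, Finset.sum_mul, Finset.mul_sum, antipode_mul_antidistrib]
  have h : (convInrAntipode k H * (convInr k H * convInl k H)) p = p ⊗ₜ[k] (1 : H) := by
    rw [← mul_assoc, convInrAntipode_mul_convInr, one_mul, convInl_apply]
  rw [(ℛ k p).convMul_apply] at h
  replace h := congr((1 ⊗ₜ[k] a) * $h)
  rw [hθ]
  simp only [map_sum, TensorProduct.map_tmul, hφ, mulLeftSnd_tmul]
  rw [← map_sum]
  simp only [convInrAntipode_apply, Finset.mul_sum, ← mul_assoc, tmul_mul_tmul, one_mul,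
    mul_one] at h
  rw [h, TensorProduct.map_tmul]

end HopfAlgebra

theorem mirrorAntipode_involutive
    {H : Type*} [Semiring H] [HopfAlgebra k H]
    -- the antipode of H squares to the identity
    (hS2 : ∀ x : H, HopfAlgebra.antipode (R := k) (HopfAlgebra.antipode (R := k) x) = x) :
    ∀ a g : H, mirrorAntipode k H (mirrorAntipode k H (a ⊗ₜ g)) = a ⊗ₜ g := by
  intro a g
  apply HopfAlgebra.mulRightSnd_comul_injective
  have hT (t : H ⊗[k] H) : mirrorAntipode k H t = HopfAlgebra.mirrorAntipodeFactor
      (HopfAlgebra.mulRightSnd (WithConv.toConv Coalgebra.comul) t) := by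
    induction t with
    | zero => simp
    | add x y hx hy => simp [hx, hy]
    | tmul a g => exact HopfAlgebra.mirrorAntipode_tmul a g
  have hflip (t : H ⊗[k] H) : HopfAlgebra.mulRightSnd (WithConv.toConv Coalgebra.comul)
      (HopfAlgebra.mirrorAntipodeFactor t) = TensorProduct.comm k H H
        (TensorProduct.map (HopfAlgebra.antipode k) (HopfAlgebra.antipode k) t) := by
    induction t with
    | zero => simp
    | add x y hx hy => simp [hx, hy]
    | tmul a p => simp [HopfAlgebra.mulRightSnd_comul_mirrorAntipodeFactor hS2]
  have hinv (t : H ⊗[k] H) : TensorProduct.comm k H H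
      (TensorProduct.map (HopfAlgebra.antipode k) (HopfAlgebra.antipode k)
        (TensorProduct.comm k H H
          (TensorProduct.map (HopfAlgebra.antipode k) (HopfAlgebra.antipode k) t))) = t := by
    induction t with
    | zero => simp
    | add x y hx hy => simp [hx, hy]
    | tmul a p => simp [hS2]
  rw [hT, hflip, hT, hflip, hinv]
end
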